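/- arXiv:1504.04615 — 5 statements merged into one kernel-verified Lean document; each statement's English description precedes it below -/
import Mathlib

section
/- Consider the k-user MISO BC with hybrid CSIT and a fixed linear coding strategy of block length n with precoding matrices V_1^n,…,V_k^n. Let j be a receiver index with CSIT state I_j ∈ {D, N} and let S ⊆ {1,…,k}. For t ∈ {1,…,n}, let A_t be the event that rank[G_j^t[∪_{i∈S}V_i^t]] = rank[G_j^{t−1}[∪_{i∈S}V_i^{t−1}]], and let B_t be the event that rowspan[∪_{i∈S}V_i(t)] ⊆ rowspan[G_j^{t−1}[∪_{i∈S}V_i^{t−1}]]. Then Pr( ∪_{t=1}^n (A_t ∩ B_t^c) ) = 0. -/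
open MeasureTheory Matrix Filter Topology

noncomputable section

/-- CSIT state of a receiver: instantaneous (`P`), delayed (`D`), or none (`N`). -/
inductive CSITState : Type
  | P : CSITState
  | D : CSITState
  | N : CSITState
  deriving DecidableEq

/-- A channel realization: for each receiver `j`, time slot `t` and transmit antenna `a`,
the channel coefficient `g j t a`. -/
abbrev Chan (k m n : ℕ) : Type := Fin k → Fin n → Fin m → ℂ

/-- Joint law of the channel coefficients: all entries i.i.d. with common law `μ`. -/
def chanMeasure (k m n : ℕ) (μ : Measure ℂ) : Measure (Chan k m n) :=
  Measure.pi fun _ : Fin k => Measure.pi fun _ : Fin n => Measure.pi fun _ : Fin m => μ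

/-- The block-diagonal channel matrix `G_j^n ∈ ℂ^{n × nm}` of a receiver with
channel vectors `g (t) ∈ ℂ^{1 × m}`. -/
def blockDiag {m n : ℕ} (g : Fin n → Fin m → ℂ) : Matrix (Fin n) (Fin n × Fin m) ℂ :=
  Matrix.of fun t p => if p.1 = t then g t p.2 else 0

/-- A linear coding strategy of block length `n` for the `k`-user MISO BC with `m`
transmit antennas and hybrid CSIT configuration `I`. -/
structure Strategy (k m n : ℕ) (I : Fin k → CSITState) : Type where
  /-- number of information symbols `m_j(n)` for receiver `j` -/
  dim : Fin k → ℕ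
  /-- precoding matrix `V_j(t) ∈ ℂ^{m × m_j(n)}`, a function of the channel realization -/
  pre : (j : Fin k) → Fin n → Chan k m n → Matrix (Fin m) (Fin (dim j)) ℂ
  /-- each precoder is a measurable function of the channels -/
  meas : ∀ j t a c, Measurable fun g => pre j t g a c
  /-- `V_j(t)` depends only on the CSIT available at time `t`: current and past channels of
  receivers with instantaneous CSIT, and strictly past channels of receivers with delayed
  CSIT (and nothing from receivers with no CSIT). -/
  causal : ∀ (j : Fin k) (t : Fin n) (g g' : Chan k m n),
    (∀ i, I i = CSITState.P → ∀ s : Fin n, (s : ℕ) ≤ (t : ℕ) → g i s = g' i s) →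
    (∀ i, I i = CSITState.D → ∀ s : Fin n, (s : ℕ) < (t : ℕ) → g i s = g' i s) →
    pre j t g = pre j t g'

namespace Strategy

variable {k m n : ℕ} {I : Fin k → CSITState}

/-- The overall precoding matrix `V_j^n ∈ ℂ^{nm × m_j(n)}` (vertical concatenation of the
`V_j(t)`). -/
def Vn (f : Strategy k m n I) (j : Fin k) (g : Chan k m n) :
    Matrix (Fin n × Fin m) (Fin (f.dim j)) ℂ :=
  Matrix.of fun r c => f.pre j r.1 g r.2 c

/-- Horizontal concatenation `[∪_{i ∈ S} V_i^n]` of the precoding matrices of the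
receivers in `S`. -/
def VS (f : Strategy k m n I) (S : Finset (Fin k)) (g : Chan k m n) :
    Matrix (Fin n × Fin m) ((i : {x // x ∈ S}) × Fin (f.dim i.1)) ℂ :=
  Matrix.of fun r c => f.Vn c.1.1 g r c.2

/-- The received-signal matrix `G_j^n [∪_{i ∈ S} V_i^n]` at receiver `j`. -/
def recvS (f : Strategy k m n I) (S : Finset (Fin k)) (j : Fin k) (g : Chan k m n) :
    Matrix (Fin n) ((i : {x // x ∈ S}) × Fin (f.dim i.1)) ℂ :=
  blockDiag (g j) * f.VS S g

/-- The received-signal matrix `G_j^n V_j^n` at receiver `j` from its own precoder. -/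
def recv1 (f : Strategy k m n I) (j : Fin k) (g : Chan k m n) :
    Matrix (Fin n) (Fin (f.dim j)) ℂ :=
  blockDiag (g j) * f.Vn j g

/-- `G_j^t [∪_{i ∈ S} V_i^t]`: the received signal matrix restricted to the first `t`
time slots (rows beyond `t` set to zero, so that its rank is that of the truncated
matrix, with the `t = 0` convention of rank `0`). -/
def recvUpTo (f : Strategy k m n I) (S : Finset (Fin k)) (j : Fin k)
    (g : Chan k m n) (t : ℕ) :
    Matrix (Fin n) ((i : {x // x ∈ S}) × Fin (f.dim i.1)) ℂ :=
  Matrix.of fun s c => if (s : ℕ) < t then f.recvS S j g s c else 0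

/-- Decodability: for every receiver `j`, almost surely
`rank[G_j^n[∪_i V_i^n]] − rank[G_j^n[∪_{i ≠ j} V_i^n]] = rank[G_j^n V_j^n] = m_j(n)`. -/
def Decodable (f : Strategy k m n I) (μ : Measure ℂ) : Prop :=
  ∀ j : Fin k, ∀ᵐ g ∂ chanMeasure k m n μ,
    (f.recvS Finset.univ j g).rank - (f.recvS (Finset.univ.erase j) j g).rank
        = (f.recv1 j g).rank ∧
    (f.recv1 j g).rank = f.dim j

end Strategy

/-- A DoF tuple is linearly achievable if there is a sequence of decodable strategies
achieving it in the limit. -/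
def LinAchievable (k m : ℕ) (I : Fin k → CSITState) (μ : Measure ℂ) (d : Fin k → ℝ) : Prop :=
  (∀ j, 0 ≤ d j ∧ d j ≤ 1) ∧
  ∃ F : (n : ℕ) → Strategy k m n I,
    (∀ n, (F n).Decodable μ) ∧
    ∀ j, Tendsto (fun n : ℕ => ((F n).dim j : ℝ) / n) atTop (nhds (d j))

/-- The linear degrees-of-freedom region: closure of the set of linearly achievable tuples. -/
def LDoFRegion (k m : ℕ) (I : Fin k → CSITState) (μ : Measure ℂ) : Set (Fin k → ℝ) :=
  closure {d | LinAchievable k m I μ d}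

/-- The linear sum degrees of freedom. -/
def LDoFSum (k m : ℕ) (I : Fin k → CSITState) (μ : Measure ℂ) : ℝ :=
  sSup ((fun d => ∑ j, d j) '' LDoFRegion k m I μ)

/-- The set `𝒫` of receivers supplying instantaneous CSIT. -/
def stateP (k : ℕ) (I : Fin k → CSITState) : Finset (Fin k) :=
  Finset.univ.filter fun i => I i = CSITState.P

/-- The set `𝒟` of receivers supplying delayed CSIT. -/
def stateD (k : ℕ) (I : Fin k → CSITState) : Finset (Fin k) :=
  Finset.univ.filter fun i => I i = CSITState.D

/-- The set `𝒩` of receivers supplying no CSIT. -/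
def stateN (k : ℕ) (I : Fin k → CSITState) : Finset (Fin k) :=
  Finset.univ.filter fun i => I i = CSITState.N


/-- A measurable set in a finite product space is null as soon as all its slices in one
coordinate direction are null. -/
theorem measure_pi_eq_zero_of_forall_update {ι : Type*} [Fintype ι] [DecidableEq ι]
    {X : ι → Type*} [∀ i, MeasurableSpace (X i)] (ν : ∀ i, Measure (X i))
    [∀ i, SigmaFinite (ν i)] {s : Set (∀ i, X i)} (hs : MeasurableSet s) (i : ι)
    (h : ∀ x, ν i {y | Function.update x i y ∈ s} = 0) : Measure.pi ν s = 0 := by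
  rcases s.eq_empty_or_nonempty with rfl | ⟨x, -⟩
  · simp
  have hf : Measurable (s.indicator (1 : (∀ i, X i) → ENNReal)) := measurable_one.indicator hs
  have hslice : ∀ x, ∫⁻ y, s.indicator (1 : (∀ i, X i) → ENNReal) (Function.update x i y) ∂ν i
      = 0 := by
    intro x
    have hm : MeasurableSet {y | Function.update x i y ∈ s} := measurable_update x hs
    rw [← h x, ← lintegral_indicator_one hm]
    rfl
  rw [← lintegral_indicator_one hs, lintegral_eq_lmarginal_univ x,
    lmarginal_erase' _ hf (Finset.mem_univ i)]
  simp only [hslice]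
  simp [lmarginal]

/-- Proper subspaces of `ℂ^ι` are null for a product of atomless laws. -/
theorem measure_pi_submodule_eq_zero {ι : Type*} [Fintype ι] (μ : Measure ℂ) [SigmaFinite μ]
    [NullSingletonClass μ] (p : Submodule ℂ (ι → ℂ)) (hp : p ≠ ⊤) :
    Measure.pi (fun _ : ι => μ) (p : Set (ι → ℂ)) = 0 := by
  classical
  obtain ⟨i, hi⟩ : ∃ i, Pi.single i (1 : ℂ) ∉ p := by
    by_contra! h
    refine hp (eq_top_iff.2 fun x _ => ?_)
    rw [pi_eq_sum_univ' x]
    exact p.sum_mem fun i _ => p.smul_mem _ (h i)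
  refine measure_pi_eq_zero_of_forall_update _ p.closed_of_finiteDimensional.measurableSet i
    fun x => Set.Subsingleton.measure_zero (fun y hy y' hy' => ?_) μ
  by_contra hne
  have hsub : (y - y') • Pi.single i (1 : ℂ) ∈ p := by
    convert p.sub_mem hy hy' using 1
    ext b
    by_cases hb : b = i
    · subst hb; simp
    · simp [hb]
  exact hi ((p.smul_mem_iff (sub_ne_zero.2 hne)).1 hsub)

/-- Linear independence of a measurable finite family of vectors is a measurable event. -/
theorem measurableSet_linearIndependent {Ω ι C : Type*} [MeasurableSpace Ω] [Finite ι]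
    [Fintype C] {v : Ω → ι → C → ℂ} (hv : ∀ i c, Measurable fun ω => v ω i c) :
    MeasurableSet {ω | LinearIndependent ℂ (v ω)} := by
  cases nonempty_fintype ι
  have hm : Measurable v := measurable_pi_iff.2 fun i => measurable_pi_iff.2 fun c => hv i c
  exact hm isOpen_setOfPred_linearIndependent.measurableSet

theorem linearIndependent_option_elim {ι K V : Type*} [DivisionRing K] [AddCommGroup V]
    [Module K V] {x : V} {v : ι → V} :
    LinearIndependent K (fun o : Option ι => o.elim x v) ↔
      LinearIndependent K v ∧ x ∉ Submodule.span K (Set.range v) :=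
  linearIndependent_option

namespace Strategy

variable {k m n : ℕ} {I : Fin k → CSITState}

theorem recvS_apply (f : Strategy k m n I) (S : Finset (Fin k)) (j : Fin k) (g : Chan k m n)
    (s : Fin n) (c) : f.recvS S j g s c = ∑ a, g j s a * f.VS S g (s, a) c := by
  simp [recvS, _root_.blockDiag, Matrix.mul_apply, Fintype.sum_prod_type, ite_mul,
    Finset.sum_ite_irrel]

theorem recvUpTo_of_lt (f : Strategy k m n I) (S : Finset (Fin k)) (j : Fin k)
    (g : Chan k m n) {t : ℕ} {s : Fin n} (h : (s : ℕ) < t) :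
    f.recvUpTo S j g t s = f.recvS S j g s :=
  funext fun _ => if_pos h

theorem recvUpTo_of_not_lt (f : Strategy k m n I) (S : Finset (Fin k)) (j : Fin k)
    (g : Chan k m n) {t : ℕ} {s : Fin n} (h : ¬ (s : ℕ) < t) :
    f.recvUpTo S j g t s = 0 :=
  funext fun _ => if_neg h

theorem measurable_VS (f : Strategy k m n I) (S : Finset (Fin k)) (r c) :
    Measurable fun g => f.VS S g r c :=
  f.meas _ _ _ _

theorem measurable_recvS (f : Strategy k m n I) (S : Finset (Fin k)) (j : Fin k) (s c) :
    Measurable fun g => f.recvS S j g s c := by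
  simp only [recvS_apply]
  have := f.measurable_VS S
  fun_prop

theorem measurable_recvUpTo (f : Strategy k m n I) (S : Finset (Fin k)) (j : Fin k) (t : ℕ)
    (s c) : Measurable fun g => f.recvUpTo S j g t s c := by
  by_cases h : (s : ℕ) < t
  · simpa only [recvUpTo_of_lt _ _ _ _ h] using f.measurable_recvS S j s c
  · simp [recvUpTo_of_not_lt _ _ _ _ h]

/-- Precoders up to time `t` ignore the time-`t` channel of a receiver without instantaneous
CSIT. -/
theorem VS_update (f : Strategy k m n I) (S : Finset (Fin k)) {j : Fin k}
    (hj : I j ≠ CSITState.P) {s t : Fin n} (hst : s ≤ t) (g : Chan k m n) (y : Fin m → ℂ) (a c) :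
    f.VS S (Function.update g j (Function.update (g j) t y)) (s, a) c = f.VS S g (s, a) c := by
  have h := f.causal c.1.1 s (Function.update g j (Function.update (g j) t y)) g
    (fun i hi _ _ => by
      rw [Function.update_of_ne]
      rintro rfl
      exact hj hi)
    (fun i _ s' hs' => by
      have hne : s' ≠ t := Fin.ne_of_lt (lt_of_lt_of_le hs' hst)
      by_cases hij : i = j
      · subst hij; simp [hne]
      · simp [hij])
  exact congrFun₂ h a c.2

theorem recvUpTo_update (f : Strategy k m n I) (S : Finset (Fin k)) {j : Fin k}
    (hj : I j ≠ CSITState.P) (t : Fin n) (g : Chan k m n) (y : Fin m → ℂ) :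
    f.recvUpTo S j (Function.update g j (Function.update (g j) t y)) t = f.recvUpTo S j g t := by
  ext s c
  by_cases h : (s : ℕ) < t
  · have hst : s < t := h
    simp [recvUpTo_of_lt _ _ _ _ h, recvS_apply, f.VS_update S hj hst.le, hst.ne]
  · simp [recvUpTo_of_not_lt _ _ _ _ h]

/-- If the received dimension does not increase at time `t`, then the signal received at time
`t` lies in the span of the earlier ones. -/
theorem recvS_mem_span (f : Strategy k m n I) (S : Finset (Fin k)) (j : Fin k)
    (g : Chan k m n) (t : Fin n)
    (h : (f.recvUpTo S j g ((t : ℕ) + 1)).rank = (f.recvUpTo S j g (t : ℕ)).rank) :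
    (f.recvS S j g).row t ∈ Submodule.span ℂ (Set.range (f.recvUpTo S j g t).row) := by
  rw [Matrix.rank_eq_finrank_span_row, Matrix.rank_eq_finrank_span_row] at h
  have hle : Submodule.span ℂ (Set.range (f.recvUpTo S j g t).row)
      ≤ Submodule.span ℂ (Set.range (f.recvUpTo S j g ((t : ℕ) + 1)).row) := by
    rw [Submodule.span_le]
    rintro _ ⟨s, rfl⟩
    by_cases hs : (s : ℕ) < t
    · exact Submodule.subset_span ⟨s, (f.recvUpTo_of_lt S j g (Nat.lt_succ_of_lt hs)).trans
        (f.recvUpTo_of_lt S j g hs).symm⟩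
    · have hzero : (f.recvUpTo S j g t).row s = 0 := f.recvUpTo_of_not_lt S j g hs
      exact hzero ▸ Submodule.zero_mem _
  rw [Submodule.eq_of_le_of_finrank_eq hle h.symm]
  exact Submodule.subset_span ⟨t, recvUpTo_of_lt _ _ _ _ (Nat.lt_succ_self _)⟩

/-- For a linearly independent selection of past received signals, the event that a row of the
current precoder is independent of them while the current received signal is not is null. -/
theorem measure_linearIndependent_not_linearIndependent (f : Strategy k m n I) (μ : Measure ℂ)
    [IsProbabilityMeasure μ] [NullSingletonClass μ] {j : Fin k} (hj : I j ≠ CSITState.P)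
    (S : Finset (Fin k)) (t : Fin n) (s : Set (Fin n)) (a : Fin m) :
    chanMeasure k m n μ
      {g | LinearIndependent ℂ (fun o : Option s =>
            o.elim ((f.VS S g).row (t, a)) fun i => (f.recvUpTo S j g t).row i) ∧
          ¬ LinearIndependent ℂ (fun o : Option s =>
            o.elim ((f.recvS S j g).row t) fun i => (f.recvUpTo S j g t).row i)} = 0 := by
  have hmeas : ∀ r : Chan k m n → _ → ℂ, (∀ c, Measurable fun g => r g c) →
      MeasurableSet {g | LinearIndependent ℂ (fun o : Option s =>
        o.elim (r g) fun i => (f.recvUpTo S j g t).row i)} := by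
    intro r hr
    refine measurableSet_linearIndependent fun o c => ?_
    cases o with
    | none => exact hr c
    | some i => exact f.measurable_recvUpTo S j t i c
  have hB := (hmeas (fun g => _) (f.measurable_VS S (t, a))).inter
    (hmeas (fun g => _) (f.measurable_recvS S j t)).compl
  refine measure_pi_eq_zero_of_forall_update _ hB j fun x => ?_
  refine measure_pi_eq_zero_of_forall_update _ (measurable_update x hB) t fun z => ?_
  set g : Chan k m n := Function.update x j z with hg
  have hupd : ∀ y, Function.update x j (Function.update z t y)
      = Function.update g j (Function.update (g j) t y) := by
    intro y; simp [hg]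
  have hV : ∀ y b, (f.VS S (Function.update g j (Function.update (g j) t y))).row (t, b)
      = (f.VS S g).row (t, b) := fun y b => funext fun c => f.VS_update S hj le_rfl g y b c
  let L := Fintype.linearCombination ℂ fun b => (f.VS S g).row (t, b)
  have hL : ∀ y, (f.recvS S j (Function.update g j (Function.update (g j) t y))).row t
      = L y := by
    intro y
    ext c
    simp [L, Fintype.linearCombination_apply, recvS_apply, f.VS_update S hj le_rfl]
  set W := Submodule.span ℂ (Set.range fun i : s => (f.recvUpTo S j g t).row i)
  simp only [linearIndependent_option_elim, Set.mem_ofPred_eq, hupd, hV, hL,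
    f.recvUpTo_update S hj]
  by_cases ha : (f.VS S g).row (t, a) ∈ W
  · simp [W, ha]
  · refine measure_mono_null (fun y hy => ?_)
      (measure_pi_submodule_eq_zero μ (W.comap L) fun htop => ha ?_)
    · by_contra hy'
      exact hy.2 ⟨hy.1.1, hy'⟩
    · have : Pi.single a (1 : ℂ) ∈ W.comap L := htop ▸ Submodule.mem_top
      simpa [L] using this

end Strategy

/-- **Lemma 10 (delayed/no-CSIT dimension-increment lemma).** If receiver `j` supplies
delayed or no CSIT, then with probability zero does there exist a time slot `t` at which
the received-signal dimension at `j` does not increase (event `A_t`) while the row span of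
the transmitted matrix `[∪_{i∈S}V_i(t)]` is not contained in the row span of
`G_j^{t-1}[∪_{i∈S}V_i^{t-1}]` (event `B_tᶜ`). -/
theorem delayed_csit_increment_lemma (k m n : ℕ) (hkm : k ≤ m)
    (I : Fin k → CSITState) (μ : Measure ℂ) [IsProbabilityMeasure μ]
    (hac : μ ≪ (volume : Measure ℂ)) (f : Strategy k m n I)
    (j : Fin k) (hj : I j = CSITState.D ∨ I j = CSITState.N)
    (S : Finset (Fin k)) :
    chanMeasure k m n μ
      {g : Chan k m n | ∃ t : Fin n,
        ((f.recvUpTo S j g ((t : ℕ) + 1)).rank = (f.recvUpTo S j g (t : ℕ)).rank) ∧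
        ¬ (Submodule.span ℂ
              (Set.range fun a : Fin m => fun c => f.VS S g (t, a) c)
            ≤ Submodule.span ℂ
              (Set.range fun s : Fin n => fun c => f.recvUpTo S j g (t : ℕ) s c))} = 0 := by
  have hP : I j ≠ CSITState.P := by rcases hj with h | h <;> simp [h]
  have : NullSingletonClass μ := ⟨fun x => hac (measure_singleton x)⟩
  refine measure_mono_null (fun g => ?_) (measure_iUnion_null fun t => measure_iUnion_null
    fun s => measure_iUnion_null fun a =>
      f.measure_linearIndependent_not_linearIndependent μ hP S t s a)
  rintro ⟨t, hrank, hspan⟩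
  obtain ⟨a, ha⟩ : ∃ a, (f.VS S g).row (t, a) ∉
      Submodule.span ℂ (Set.range (f.recvUpTo S j g t).row) := by
    by_contra! h
    exact hspan (Submodule.span_le.2 (Set.range_subset_iff.2 h))
  obtain ⟨b, -, -, hb_span, hb_li⟩ :=
    exists_linearIndepOn_extension (linearIndepOn_empty ℂ (f.recvUpTo S j g t).row)
      (Set.empty_subset Set.univ)
  rw [Set.image_univ, ← Submodule.span_le, Set.image_eq_range] at hb_span
  have hb_le : Submodule.span ℂ (Set.range fun i : b => (f.recvUpTo S j g t).row i)
      ≤ Submodule.span ℂ (Set.range (f.recvUpTo S j g t).row) :=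
    Submodule.span_mono (Set.range_subset_iff.2 fun i => ⟨i, rfl⟩)
  simp only [Set.mem_iUnion]
  exact ⟨t, b, a, linearIndependent_option_elim.2 ⟨hb_li, fun h => ha (hb_le h)⟩,
    fun h => (linearIndependent_option_elim.1 h).2 (hb_span (f.recvS_mem_span S j g t hrank))⟩

end
end

section
/- Let A and B be matrices over a field with the same number of rows, with p and q columns respectively, and let [A B] denote their horizontal concatenation. Then rank[A B] − rank(B) equals the dimension of the subspace of row vectors { s ∈ 𝔽^{1×p} : [s 0_{1×q}] ∈ rowspan[A B] }, i.e., the dimension of the intersection of rowspan[A B] with the subspace of vectors whose last q coordinates are zero. -/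
noncomputable section

/-- The linear map `𝔽^p → 𝔽^{p ⊕ q}` sending `v` to `[v 0]` (padding with zeros on the
last `q` coordinates). -/
def padRight (F : Type*) [Field F] (p q : ℕ) : (Fin p → F) →ₗ[F] (Fin p ⊕ Fin q → F) where
  toFun v := Sum.elim v 0
  map_add' u v := by funext c; cases c <;> simp
  map_smul' a v := by funext c; cases c <;> simp

theorem padRight_injective (F : Type*) [Field F] (p q : ℕ) :
    Function.Injective (padRight F p q) := fun u v h => by
  funext c
  exact congrFun h (Sum.inl c)

theorem range_padRight (F : Type*) [Field F] (p q : ℕ) :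
    LinearMap.range (padRight F p q) =
      LinearMap.ker (LinearMap.funLeft F F (Sum.inr : Fin q → Fin p ⊕ Fin q)) := by
  ext w
  simp only [LinearMap.mem_range, LinearMap.mem_ker]
  constructor
  · rintro ⟨v, rfl⟩
    rfl
  · intro hw
    refine ⟨w ∘ Sum.inl, ?_⟩
    funext c
    cases c with
    | inl c => rfl
    | inr c => exact (congrFun hw c).symm

theorem Submodule.finrank_map_add_finrank_inf_ker {K V W : Type*} [DivisionRing K]
    [AddCommGroup V] [Module K V] [AddCommGroup W] [Module K W] [FiniteDimensional K V]
    (f : V →ₗ[K] W) (S : Submodule K V) :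
    Module.finrank K (S.map f) + Module.finrank K (S ⊓ LinearMap.ker f : Submodule K V) =
      Module.finrank K S := by
  rw [← LinearMap.finrank_range_add_finrank_ker (f.domRestrict S), LinearMap.range_domRestrict,
    LinearMap.ker_domRestrict, ← Submodule.map_comap_subtype,
    Submodule.finrank_map_subtype_eq]

/-- **Claim (rank difference as a dimension).** For matrices `A` (with `p` columns) and
`B` (with `q` columns) having the same rows, `rank[A B] − rank B` equals the dimension of
`{s ∈ 𝔽^{1×p} : [s 0] ∈ rowspan[A B]}`. -/
theorem rank_sub_rank_eq_dim_padded {F : Type*} [Field F] {r p q : ℕ}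
    (A : Matrix (Fin r) (Fin p) F) (B : Matrix (Fin r) (Fin q) F) :
    (Matrix.of fun (i : Fin r) => Sum.elim (A i) (B i)).rank - B.rank
      = Module.finrank F
          ((Submodule.span F (Set.range fun i : Fin r => Sum.elim (A i) (B i))).comap
            (padRight F p q)) := by
  set S := Submodule.span F (Set.range fun i : Fin r => Sum.elim (A i) (B i)) with hS
  have hB : S.map (LinearMap.funLeft F F (Sum.inr : Fin q → Fin p ⊕ Fin q)) =
      Submodule.span F (Set.range B.row) := by
    rw [hS, Submodule.map_span, ← Set.range_comp]
    rfl
  have hpad : Module.finrank F (S.comap (padRight F p q)) =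
      Module.finrank F (S ⊓ LinearMap.ker
        (LinearMap.funLeft F F (Sum.inr : Fin q → Fin p ⊕ Fin q)) : Submodule F _) := by
    rw [(Submodule.equivMapOfInjective _ (padRight_injective F p q) _).finrank_eq,
      Submodule.map_comap_eq, range_padRight, inf_comm]
  have hrank : (Matrix.of fun (i : Fin r) => Sum.elim (A i) (B i)).rank = Module.finrank F S :=
    Matrix.rank_eq_finrank_span_row _
  have key := Submodule.finrank_map_add_finrank_inf_ker
    (LinearMap.funLeft F F (Sum.inr : Fin q → Fin p ⊕ Fin q)) S
  rw [hB, ← Matrix.rank_eq_finrank_span_row] at key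
  rw [hrank, hpad]
  omega

end
end

section
/- Let A, B, C, D be matrices over a field such that the block matrix [A B; C D] is well-formed (A and B have the same number of rows, C and D have the same number of rows, A and C have the same number of columns, B and D have the same number of columns). Then rank[A B] − rank(B) ≤ rank[A B; C D] − rank[B; D], where [A B] denotes horizontal concatenation and [B; D] vertical concatenation. -/
noncomputable section

/-- The drop in dimension of a subspace under a linear map is monotone in the subspace. -/
theorem Submodule.finrank_add_finrank_map_le {K V W : Type*} [Field K] [AddCommGroup V]
    [Module K V] [FiniteDimensional K V] [AddCommGroup W] [Module K W] (f : V →ₗ[K] W)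
    {S T : Submodule K V} (h : S ≤ T) :
    Module.finrank K S + Module.finrank K (T.map f) ≤
      Module.finrank K T + Module.finrank K (S.map f) := by
  have key (U : Submodule K V) : Module.finrank K (U.map f) +
      Module.finrank K (U ⊓ LinearMap.ker f : Submodule K V) = Module.finrank K U := by
    rw [← LinearMap.finrank_range_add_finrank_ker (f.domRestrict U), LinearMap.range_domRestrict,
      LinearMap.ker_domRestrict, ← Submodule.map_comap_subtype, Submodule.finrank_map_subtype_eq]
  have := key S
  have := key T
  have := Submodule.finrank_mono (inf_le_inf_right (LinearMap.ker f) h)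
  omega

/-- Selecting columns of a matrix maps its row space under the coordinate restriction. -/
theorem Matrix.span_row_submatrix_id {K m n n₀ : Type*} [Semiring K] (M : Matrix m n K)
    (c : n₀ → n) :
    Submodule.span K (Set.range (M.submatrix id c).row) =
      (Submodule.span K (Set.range M.row)).map (LinearMap.funLeft K K c) := by
  rw [Submodule.map_span, ← Set.range_comp]
  rfl

/-- Submodularity of the rank of a matrix with respect to selecting rows and columns. -/
theorem Matrix.rank_submatrix_add_rank_submatrix_le {K m n m₀ n₀ : Type*} [Field K] [Finite m]
    [Fintype n] [Finite m₀] [Fintype n₀] (M : Matrix m n K) (r : m₀ → m) (c : n₀ → n) :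
    (M.submatrix r id).rank + (M.submatrix id c).rank ≤ M.rank + (M.submatrix r c).rank := by
  have hle : Submodule.span K (Set.range (M.submatrix r id).row) ≤
      Submodule.span K (Set.range M.row) := by
    apply Submodule.span_mono
    rintro _ ⟨i, rfl⟩
    exact ⟨r i, rfl⟩
  have hrc : M.submatrix r c = (M.submatrix r id).submatrix id c := rfl
  rw [hrc]
  simp only [Matrix.rank_eq_finrank_span_row]
  rw [Matrix.span_row_submatrix_id M, Matrix.span_row_submatrix_id (M.submatrix r id)]
  exact Submodule.finrank_add_finrank_map_le _ hle

/-- For block matrices, `rank[A B] − rank B ≤ rank[A B; C D] − rank[B; D]`. -/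
theorem rank_block_diff_le {F : Type*} [Field F] {r₁ r₂ p q : ℕ}
    (A : Matrix (Fin r₁) (Fin p) F) (B : Matrix (Fin r₁) (Fin q) F)
    (C : Matrix (Fin r₂) (Fin p) F) (D : Matrix (Fin r₂) (Fin q) F) :
    ((Matrix.of fun (i : Fin r₁) => Sum.elim (A i) (B i)).rank : ℤ) - (B.rank : ℤ)
      ≤ ((Matrix.fromBlocks A B C D).rank : ℤ)
        - ((Matrix.of fun (i : Fin r₁ ⊕ Fin r₂) (c : Fin q) =>
              Sum.elim (fun a => B a c) (fun a => D a c) i).rank : ℤ) := by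
  have hAB : (Matrix.of fun (i : Fin r₁) => Sum.elim (A i) (B i)) =
      (Matrix.fromBlocks A B C D).submatrix Sum.inl id := by
    ext i (j | j) <;> rfl
  have hBD : (Matrix.of fun (i : Fin r₁ ⊕ Fin r₂) (c : Fin q) =>
      Sum.elim (fun a => B a c) (fun a => D a c) i) =
      (Matrix.fromBlocks A B C D).submatrix id Sum.inr := by
    ext (i | i) j <;> rfl
  have hB : B = (Matrix.fromBlocks A B C D).submatrix Sum.inl Sum.inr := rfl
  have h := Matrix.rank_submatrix_add_rank_submatrix_le (Matrix.fromBlocks A B C D)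
    Sum.inl Sum.inr
  rw [← hAB, ← hBD, ← hB] at h
  omega

end
end

section
/- Consider the 3-user MISO BC with hybrid CSIT in which receiver 2 has CSIT state I_2 = D and receiver 3 has CSIT state I_3 = N (receiver 1 may have any CSIT state). For every decodable linear coding strategy of block length n, almost surely both (1/2)·m_1(n) + m_2(n) + m_3(n) ≤ n and m_1(n) + m_3(n) ≤ n. -/
open MeasureTheory Matrix Filter Topology

noncomputable section

section Resampling

variable {ι : Type*} [Fintype ι] [DecidableEq ι] {α : ι → Type*} [∀ i, MeasurableSpace (α i)]

lemma measurePreserving_update (ν : ∀ i, Measure (α i)) [∀ i, IsProbabilityMeasure (ν i)] (i : ι) :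
    MeasurePreserving (fun p : (∀ j, α j) × α i => Function.update p.1 i p.2)
      ((Measure.pi ν).prod (ν i)) (Measure.pi ν) := by
  have hmeas : Measurable fun p : (∀ j, α j) × α i => Function.update p.1 i p.2 := by
    refine measurable_pi_iff.2 fun j => ?_
    rcases eq_or_ne j i with rfl | hj
    · simpa using measurable_snd
    · simpa [hj, Function.comp_def] using (measurable_pi_apply j).comp measurable_fst
  refine ⟨hmeas, (Measure.pi_eq fun s hs => ?_).symm⟩
  have hpre : (fun p : (∀ j, α j) × α i => Function.update p.1 i p.2) ⁻¹' Set.univ.pi s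
      = Set.univ.pi (Function.update s i Set.univ) ×ˢ s i := by
    ext ⟨g, x⟩
    simp only [Set.mem_preimage, Set.mem_univ_pi, Set.mem_prod]
    refine ⟨fun h => ⟨fun j => ?_, by simpa using h i⟩, fun h j => ?_⟩
    · rcases eq_or_ne j i with rfl | hj
      · simp
      · simpa [hj] using h j
    · rcases eq_or_ne j i with rfl | hj
      · simpa using h.2
      · simpa [hj] using h.1 j
  rw [Measure.map_apply hmeas (MeasurableSet.univ_pi hs), hpre, Measure.prod_prod, Measure.pi_pi,
    ← Finset.mul_prod_erase _ _ (Finset.mem_univ i), ← Finset.mul_prod_erase _ _ (Finset.mem_univ i),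
    mul_comm]
  simp only [Function.update_self, measure_univ, one_mul]
  congr 1
  refine Finset.prod_congr rfl fun j hj => ?_
  rw [Function.update_of_ne (Finset.ne_of_mem_erase hj)]

/-- A measurable set is null for a product of probability measures as soon as all its sections in
the direction of one coordinate are null. -/
lemma pi_null_of_update_null (ν : ∀ i, Measure (α i)) [∀ i, IsProbabilityMeasure (ν i)] (i : ι)
    {B : Set (∀ i, α i)} (hB : MeasurableSet B)
    (h : ∀ g, ν i {x | Function.update g i x ∈ B} = 0) : Measure.pi ν B = 0 := by
  have hmp := measurePreserving_update ν i
  rw [← hmp.measure_preimage hB.nullMeasurableSet, Measure.measure_prod_null (hmp.measurable hB)]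
  exact Filter.Eventually.of_forall h

end Resampling

lemma measurableSet_setOf_mem_span_range (ι C : Type*) [Fintype ι] [Fintype C] :
    MeasurableSet {p : (C → ℂ) × (ι → C → ℂ) | p.1 ∈ Submodule.span ℂ (Set.range p.2)} := by
  have hcont : Continuous fun q : (ι → ℂ) × (ι → C → ℂ) => (∑ i, q.1 i • q.2 i, q.2) := by fun_prop
  have heq : {p : (C → ℂ) × (ι → C → ℂ) | p.1 ∈ Submodule.span ℂ (Set.range p.2)}
      = Set.range fun q : (ι → ℂ) × (ι → C → ℂ) => (∑ i, q.1 i • q.2 i, q.2) := by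
    ext ⟨w, R⟩
    simp [Submodule.mem_span_range_iff_exists_fun]
  obtain ⟨K, hK, hKU⟩ := isSigmaCompact_range hcont
  rw [heq, ← hKU]
  exact MeasurableSet.iUnion fun k => (hK k).measurableSet

/-- The channel realization `g` with the channel vector of receiver `i` at time `t` replaced
by `h`. -/
def updateChan {k m n : ℕ} (g : Chan k m n) (i : Fin k) (t : Fin n) (h : Fin m → ℂ) :
    Chan k m n :=
  Function.update g i (Function.update (g i) t h)

/-- If the rows of `A` and the family `R` do not depend on the channel vector of receiver `i` at
time `t`, then almost surely the signal received through that channel lies in the span of `R` only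
when all rows of `A` do. -/
lemma ae_rows_mem_span_of_received_mem_span {k m n : ℕ} {μ : Measure ℂ} [IsProbabilityMeasure μ]
    (hac : μ ≪ (volume : Measure ℂ)) {ι C : Type*} [Fintype ι] [Fintype C] (i : Fin k) (t : Fin n)
    {A : Chan k m n → Fin m → C → ℂ} {R : Chan k m n → ι → C → ℂ}
    (hA : Measurable A) (hR : Measurable R)
    (hAi : ∀ g h, A (updateChan g i t h) = A g) (hRi : ∀ g h, R (updateChan g i t h) = R g) :
    ∀ᵐ g ∂ chanMeasure k m n μ,
      ∑ b, g i t b • A g b ∈ Submodule.span ℂ (Set.range (R g)) →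
        ∀ a, A g a ∈ Submodule.span ℂ (Set.range (R g)) := by
  have key : ∀ a, ∀ᵐ g ∂ chanMeasure k m n μ,
      ∑ b, g i t b • A g b ∈ Submodule.span ℂ (Set.range (R g)) →
        A g a ∈ Submodule.span ℂ (Set.range (R g)) := by
    intro a
    set B : Set (Chan k m n) := {g | ∑ b, g i t b • A g b ∈ Submodule.span ℂ (Set.range (R g)) ∧
      A g a ∉ Submodule.span ℂ (Set.range (R g))} with hBdef
    have hB : MeasurableSet B := by
      have h1 : Measurable fun g : Chan k m n => (∑ b, g i t b • A g b, R g) := by fun_prop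
      have h2 : Measurable fun g : Chan k m n => (A g a, R g) := by fun_prop
      exact (h1 (measurableSet_setOf_mem_span_range ι C)).inter
        (h2 (measurableSet_setOf_mem_span_range ι C)).compl
    suffices hnull : chanMeasure k m n μ B = 0 by
      rw [ae_iff]
      convert hnull using 2
      ext g
      simp [hBdef]
    refine pi_null_of_update_null _ i hB fun g => ?_
    refine pi_null_of_update_null _ t ((measurable_update g) hB) fun y => ?_
    refine pi_null_of_update_null _ a
      ((measurable_update y) ((measurable_update g) hB)) fun h => ?_
    refine hac ((Set.Subsingleton.measure_zero ?_) volume)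
    rintro x ⟨hx, hxa⟩ x' ⟨hx', -⟩
    by_contra hne
    have hinv : ∀ z, Function.update g i (Function.update y t z)
        = updateChan (Function.update g i y) i t z := fun z => by simp [updateChan]
    simp only [hinv, hAi, hRi] at hx hx' hxa
    apply hxa
    have hsub := Submodule.sub_mem _ hx hx'
    simp only [updateChan, Function.update_self] at hsub
    rw [← Finset.sum_sub_distrib, Finset.sum_eq_single a] at hsub
    · rw [← sub_smul] at hsub
      exact (Submodule.smul_mem_iff _ (by simpa using sub_ne_zero.2 hne)).1 hsub
    · intro b _ hb
      simp [hb]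
    · simp
  exact (ae_all_iff.2 key).mono fun g hg hmem a => hg a hmem

section Rank

variable {E : Type*}

/-- The family which agrees with `v` before time `k` and with `w` from time `k` on. -/
def hybrid {n : ℕ} (v w : Fin n → E) (k : ℕ) (s : Fin n) : E :=
  if (s : ℕ) < k then v s else w s

lemma hybrid_eq_update {n : ℕ} (v w : Fin n → E) (t : Fin n) :
    hybrid v w t = Function.update (hybrid v w t) t (w t) := by
  simp [hybrid]

lemma hybrid_succ_eq_update {n : ℕ} (v w : Fin n → E) (t : Fin n) :
    hybrid v w (t + 1) = Function.update (hybrid v w t) t (v t) := by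
  ext s
  rcases eq_or_ne s t with rfl | hs
  · simp [hybrid]
  · have : (s : ℕ) < t + 1 ↔ (s : ℕ) < t := by
      have := Fin.val_ne_iff.2 hs
      lia
    simp [hybrid, hs, this]

variable [AddCommGroup E] [Module ℂ E]

lemma span_range_update {ι : Type*} [DecidableEq ι] (u : ι → E) (t : ι) (x : E) :
    Submodule.span ℂ (Set.range (Function.update u t x))
      = Submodule.span ℂ (Set.range (Function.update u t 0)) ⊔ Submodule.span ℂ {x} := by
  apply le_antisymm
  · rw [Submodule.span_le]
    rintro _ ⟨s, rfl⟩
    rcases eq_or_ne s t with rfl | hs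
    · exact Submodule.mem_sup_right (Submodule.mem_span_singleton.2 ⟨1, by simp⟩)
    · exact Submodule.mem_sup_left (Submodule.subset_span ⟨s, by simp [hs]⟩)
  · refine sup_le (Submodule.span_le.2 ?_) (Submodule.span_le.2 ?_)
    · rintro _ ⟨s, rfl⟩
      rcases eq_or_ne s t with rfl | hs
      · simp
      · exact Submodule.subset_span ⟨s, by simp [hs]⟩
    · rintro _ rfl
      exact Submodule.subset_span ⟨t, by simp⟩

lemma finrank_sup_span_singleton_le [FiniteDimensional ℂ E] (W : Submodule ℂ E) (x : E) :
    Module.finrank ℂ ↥(W ⊔ Submodule.span ℂ {x}) ≤ Module.finrank ℂ W + 1 :=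
  (Submodule.finrank_add_le_finrank_add_finrank _ _).trans
    (Nat.add_le_add_left (by simpa using finrank_span_le_card (R := ℂ) ({x} : Set E)) _)

/-- Replacing the vectors `w t` by `v t` one at a time does not decrease the rank, provided that
each `v t` is innovative whenever `w t` is. -/
lemma finrank_span_le_of_innovative [FiniteDimensional ℂ E] {n : ℕ} (v w : Fin n → E)
    (h : ∀ t : Fin n,
      v t ∈ Submodule.span ℂ (Set.range (Function.update (hybrid v w t) t 0)) →
        w t ∈ Submodule.span ℂ (Set.range (Function.update (hybrid v w t) t 0))) :
    Module.finrank ℂ (Submodule.span ℂ (Set.range w))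
      ≤ Module.finrank ℂ (Submodule.span ℂ (Set.range v)) := by
  have key : ∀ k ≤ n, Module.finrank ℂ (Submodule.span ℂ (Set.range w))
      ≤ Module.finrank ℂ (Submodule.span ℂ (Set.range (hybrid v w k))) := by
    intro k
    induction k with
    | zero =>
      intro _
      have h0 : hybrid v w 0 = w := by
        ext s
        simp [hybrid]
      rw [h0]
    | succ k ih =>
      intro hk
      refine (ih (by lia)).trans ?_
      obtain ⟨t, rfl⟩ : ∃ t : Fin n, (t : ℕ) = k := ⟨⟨k, hk⟩, rfl⟩
      rw [hybrid_succ_eq_update, hybrid_eq_update, Function.update_idem, span_range_update,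
        span_range_update _ _ (v t)]
      by_cases hv : v t ∈ Submodule.span ℂ (Set.range (Function.update (hybrid v w t) t 0))
      · refine Submodule.finrank_mono (sup_le le_sup_left ?_)
        exact ((Submodule.span_singleton_le_iff_mem _ _).2 (h t hv)).trans le_sup_left
      · rw [Submodule.finrank_sup_span_singleton hv]
        exact finrank_sup_span_singleton_le _ _
  have hn : hybrid v w n = v := by
    ext s
    simp [hybrid]
  exact hn ▸ key n le_rfl

/-- If `w t` lies in the span of the past of `v` whenever `v t` does, then the rank of `w` is at
most twice the rank of `v`. -/
lemma finrank_span_le_two_mul_of_innovative [FiniteDimensional ℂ E] {n : ℕ} (v w : Fin n → E)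
    (h : ∀ t : Fin n, v t ∈ Submodule.span ℂ (Set.range (hybrid v 0 t)) →
        w t ∈ Submodule.span ℂ (Set.range (hybrid v 0 t))) :
    Module.finrank ℂ (Submodule.span ℂ (Set.range w))
      ≤ 2 * Module.finrank ℂ (Submodule.span ℂ (Set.range v)) := by
  have hstep : ∀ (u : Fin n → E) (t : Fin n), Submodule.span ℂ (Set.range (hybrid u 0 (t + 1)))
      = Submodule.span ℂ (Set.range (hybrid u 0 t)) ⊔ Submodule.span ℂ {u t} := by
    intro u t
    rw [hybrid_succ_eq_update, span_range_update]
    congr 3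
    exact (hybrid_eq_update u 0 t).symm
  have key : ∀ k ≤ n, Module.finrank ℂ
      ↥(Submodule.span ℂ (Set.range (hybrid v 0 k)) ⊔ Submodule.span ℂ (Set.range (hybrid w 0 k)))
      ≤ 2 * Module.finrank ℂ (Submodule.span ℂ (Set.range (hybrid v 0 k))) := by
    intro k
    induction k with
    | zero =>
      intro _
      have h0 : ∀ u : Fin n → E, Submodule.span ℂ (Set.range (hybrid u 0 0)) = ⊥ := by
        intro u
        rw [Submodule.span_eq_bot]
        rintro _ ⟨s, rfl⟩
        simp [hybrid]
      rw [h0, h0]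
      simp
    | succ k ih =>
      intro hk
      specialize ih (by lia)
      obtain ⟨t, rfl⟩ : ∃ t : Fin n, (t : ℕ) = k := ⟨⟨k, hk⟩, rfl⟩
      rw [hstep, hstep, sup_sup_sup_comm]
      by_cases hv : v t ∈ Submodule.span ℂ (Set.range (hybrid v 0 t))
      · have hv' := (Submodule.span_singleton_le_iff_mem _ _).2 hv
        have hw' := (Submodule.span_singleton_le_iff_mem _ _).2 (h t hv)
        rwa [sup_eq_left.2 hv', sup_eq_left.2 ((sup_le hv' hw').trans le_sup_left)]
      · rw [Submodule.finrank_sup_span_singleton hv, ← sup_assoc]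
        refine (finrank_sup_span_singleton_le _ _).trans ?_
        have := finrank_sup_span_singleton_le (Submodule.span ℂ (Set.range (hybrid v 0 t)) ⊔
          Submodule.span ℂ (Set.range (hybrid w 0 t))) (v t)
        lia
  have hn : ∀ u : Fin n → E, hybrid u 0 n = u := fun u => by
    ext s
    simp [hybrid]
  have := key n le_rfl
  rw [hn, hn] at this
  exact (Submodule.finrank_mono le_sup_right).trans this

end Rank

namespace Strategy

variable {k m n : ℕ} {I : Fin k → CSITState}

/-- Row `a` of the precoding matrices of the receivers in `S` at time `t`. -/
def preS (f : Strategy k m n I) (S : Finset (Fin k)) (t : Fin n) (g : Chan k m n) :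
    Fin m → ((i : {x // x ∈ S}) × Fin (f.dim i.1)) → ℂ :=
  fun a c => f.pre c.1.1 t g a c.2

lemma measurable_preS (f : Strategy k m n I) (S : Finset (Fin k)) (t : Fin n) :
    Measurable (f.preS S t) :=
  measurable_pi_iff.2 fun a => measurable_pi_iff.2 fun c => f.meas c.1.1 t a c.2

lemma recvS_row (f : Strategy k m n I) (S : Finset (Fin k)) (j : Fin k) (g : Chan k m n)
    (t : Fin n) : f.recvS S j g t = ∑ a, g j t a • f.preS S t g a := by
  ext c
  simp [recvS, Matrix.mul_apply, _root_.blockDiag, VS, Vn, preS, Fintype.sum_prod_type, ite_mul]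

lemma measurable_recvS_row (f : Strategy k m n I) (S : Finset (Fin k)) (j : Fin k) (t : Fin n) :
    Measurable fun g => f.recvS S j g t := by
  simp only [recvS_row]
  have := f.measurable_preS S t
  fun_prop

lemma updateChan_apply_of_ne (g : Chan k m n) {i j : Fin k} {s t : Fin n} (h : Fin m → ℂ)
    (hne : j ≠ i ∨ s ≠ t) : updateChan g i t h j s = g j s := by
  unfold updateChan
  rcases eq_or_ne j i with rfl | hj
  · simp [hne.resolve_left (by simp)]
  · simp [hj]

/-- The precoders at time `s` do not depend on the channel vector of receiver `i` at time `t` if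
`i` supplies no CSIT, or if `i` supplies delayed CSIT and `s ≤ t`. -/
lemma preS_updateChan (f : Strategy k m n I) (S : Finset (Fin k)) {i : Fin k} {s t : Fin n}
    (hi : I i = CSITState.N ∨ (I i = CSITState.D ∧ s ≤ t)) (g : Chan k m n) (h : Fin m → ℂ) :
    f.preS S s (updateChan g i t h) = f.preS S s g := by
  ext a c
  unfold preS
  rw [f.causal c.1.1 s (updateChan g i t h) g]
  · intro j hj r _
    refine updateChan_apply_of_ne g h (Or.inl ?_)
    rintro rfl
    simp [hj] at hi
  · intro j hj r hr
    refine updateChan_apply_of_ne g h ?_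
    by_contra! hne
    obtain ⟨rfl, rfl⟩ := hne
    simp only [hj, reduceCtorEq, true_and, false_or] at hi
    exact absurd hr (not_lt.2 hi)

lemma recvS_row_updateChan (f : Strategy k m n I) (S : Finset (Fin k)) {i j : Fin k} {s t : Fin n}
    (hi : I i = CSITState.N ∨ (I i = CSITState.D ∧ s ≤ t)) (hne : j ≠ i ∨ s ≠ t)
    (g : Chan k m n) (h : Fin m → ℂ) :
    f.recvS S j (updateChan g i t h) s = f.recvS S j g s := by
  rw [recvS_row, recvS_row, f.preS_updateChan S hi, updateChan_apply_of_ne g h hne]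

variable {μ : Measure ℂ}

/-- A receiver without CSIT sees at least as many dimensions as any other receiver. -/
lemma ae_rank_recvS_le_of_noCSIT [IsProbabilityMeasure μ] (hac : μ ≪ (volume : Measure ℂ))
    (f : Strategy k m n I) (S : Finset (Fin k)) {i j : Fin k} (hi : I i = CSITState.N) :
    ∀ᵐ g ∂ chanMeasure k m n μ, (f.recvS S j g).rank ≤ (f.recvS S i g).rank := by
  have key : ∀ t : Fin n, ∀ᵐ g ∂ chanMeasure k m n μ,
      ∑ b, g i t b • f.preS S t g b ∈ Submodule.span ℂ (Set.range
          (Function.update (hybrid (f.recvS S i g) (f.recvS S j g) t) t 0)) →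
        ∀ a, f.preS S t g a ∈ Submodule.span ℂ (Set.range
          (Function.update (hybrid (f.recvS S i g) (f.recvS S j g) t) t 0)) := by
    intro t
    refine ae_rows_mem_span_of_received_mem_span hac i t (f.measurable_preS S t) ?_
      (f.preS_updateChan S (Or.inl hi)) ?_
    · refine measurable_pi_iff.2 fun s => ?_
      by_cases hs : s = t
      · subst hs
        simp [measurable_const]
      · by_cases hst : (s : ℕ) < t
        · simpa [hs, hybrid, hst] using f.measurable_recvS_row S i s
        · simpa [hs, hybrid, hst] using f.measurable_recvS_row S j s
    · intro g h
      ext1 s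
      by_cases hs : s = t
      · subst hs
        simp
      · simp [hs, hybrid, f.recvS_row_updateChan S (Or.inl hi) (Or.inr hs)]
  filter_upwards [ae_all_iff.2 key] with g hg
  rw [rank_eq_finrank_span_row, rank_eq_finrank_span_row]
  refine finrank_span_le_of_innovative (f.recvS S i g) (f.recvS S j g) fun t ht => ?_
  rw [recvS_row] at ht ⊢
  exact Submodule.sum_mem _ fun a _ => Submodule.smul_mem _ _ (hg t ht a)

/-- A receiver with delayed CSIT sees at least half as many dimensions as any other receiver. -/
lemma ae_rank_recvS_le_two_mul_of_delayedCSIT [IsProbabilityMeasure μ]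
    (hac : μ ≪ (volume : Measure ℂ)) (f : Strategy k m n I) (S : Finset (Fin k)) {i : Fin k} (j : Fin k)
    (hi : I i = CSITState.D) :
    ∀ᵐ g ∂ chanMeasure k m n μ, (f.recvS S j g).rank ≤ 2 * (f.recvS S i g).rank := by
  have key : ∀ t : Fin n, ∀ᵐ g ∂ chanMeasure k m n μ,
      ∑ b, g i t b • f.preS S t g b ∈
          Submodule.span ℂ (Set.range (hybrid (f.recvS S i g) 0 t)) →
        ∀ a, f.preS S t g a ∈
          Submodule.span ℂ (Set.range (hybrid (f.recvS S i g) 0 t)) := by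
    intro t
    refine ae_rows_mem_span_of_received_mem_span hac i t (f.measurable_preS S t) ?_
      (f.preS_updateChan S (Or.inr ⟨hi, le_rfl⟩)) ?_
    · refine measurable_pi_iff.2 fun s => ?_
      by_cases hst : (s : ℕ) < t
      · simpa [hybrid, hst] using f.measurable_recvS_row S i s
      · simp [hybrid, hst, measurable_const]
    · intro g h
      ext1 s
      by_cases hst : (s : ℕ) < t
      · simp [hybrid, hst, f.recvS_row_updateChan S (Or.inr ⟨hi, hst.le⟩)
          (Or.inr (Fin.ne_of_lt hst))]
      · simp [hybrid, hst]
  filter_upwards [ae_all_iff.2 key] with g hg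
  rw [rank_eq_finrank_span_row, rank_eq_finrank_span_row]
  refine finrank_span_le_two_mul_of_innovative (f.recvS S i g) (f.recvS S j g) fun t ht => ?_
  have hmem := hg t (by rwa [← recvS_row])
  rw [recvS_row]
  exact Submodule.sum_mem _ fun a _ => Submodule.smul_mem _ _ (hmem a)

/-- The column space of `G_j^n V_i^n`. -/
def colSpan (f : Strategy k m n I) (i j : Fin k) (g : Chan k m n) : Submodule ℂ (Fin n → ℂ) :=
  Submodule.span ℂ (Set.range (blockDiag (g j) * f.Vn i g).col)

lemma rank_recv1 (f : Strategy k m n I) (j : Fin k) (g : Chan k m n) :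
    (f.recv1 j g).rank = Module.finrank ℂ (f.colSpan j j g) :=
  rank_eq_finrank_span_cols _

lemma rank_recvS (f : Strategy k m n I) (S : Finset (Fin k)) (j : Fin k) (g : Chan k m n) :
    (f.recvS S j g).rank = Module.finrank ℂ ↥(⨆ i ∈ S, f.colSpan i j g) := by
  have h : Set.range (f.recvS S j g).col
      = ⋃ i : {x // x ∈ S}, Set.range (blockDiag (g j) * f.Vn i g).col := by
    rw [Set.range_sigma_eq_iUnion_range]
    rfl
  rw [rank_eq_finrank_span_cols, h, Submodule.span_iUnion, iSup_subtype]
  rfl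

lemma rank_recvS_singleton (f : Strategy k m n I) (j : Fin k) (g : Chan k m n) :
    (f.recvS {j} j g).rank = (f.recv1 j g).rank := by
  rw [rank_recvS, rank_recv1, Finset.iSup_singleton]

lemma Decodable.ae_disjoint {f : Strategy k m n I} (hdec : f.Decodable μ) (j : Fin k) :
    ∀ᵐ g ∂ chanMeasure k m n μ, Module.finrank ℂ (f.colSpan j j g) = f.dim j ∧
      Disjoint (⨆ i ∈ Finset.univ.erase j, f.colSpan i j g) (f.colSpan j j g) := by
  filter_upwards [hdec j] with g ⟨h1, h2⟩
  rw [rank_recv1] at h1 h2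
  refine ⟨h2, ?_⟩
  rw [rank_recvS, rank_recvS, ← Finset.insert_erase (Finset.mem_univ j), Finset.iSup_insert,
    Finset.erase_insert_eq_erase, Finset.erase_idem, sup_comm] at h1
  have h3 := Submodule.finrank_sup_add_finrank_inf_eq
    (⨆ i ∈ Finset.univ.erase j, f.colSpan i j g) (f.colSpan j j g)
  have h4 := Submodule.finrank_mono (le_sup_left :
    (⨆ i ∈ Finset.univ.erase j, f.colSpan i j g) ≤
      (⨆ i ∈ Finset.univ.erase j, f.colSpan i j g) ⊔ f.colSpan j j g)
  rw [disjoint_iff, ← Submodule.finrank_eq_zero (R := ℂ)]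
  lia

/-- A decoding receiver sees its `m_j(n)` dimensions on top of the interference of any set of
other receivers. -/
lemma Decodable.ae_rank_recvS_insert {f : Strategy k m n I} (hdec : f.Decodable μ) {j : Fin k}
    {S : Finset (Fin k)} (hj : j ∉ S) :
    ∀ᵐ g ∂ chanMeasure k m n μ,
      (f.recvS (insert j S) j g).rank = (f.recvS S j g).rank + f.dim j := by
  filter_upwards [hdec.ae_disjoint j] with g ⟨h1, h2⟩
  have h3 : Disjoint (⨆ i ∈ S, f.colSpan i j g) (f.colSpan j j g) :=
    h2.mono_left (biSup_mono fun i hi =>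
      Finset.mem_erase.2 ⟨ne_of_mem_of_not_mem hi hj, Finset.mem_univ i⟩)
  have h4 := Submodule.finrank_sup_add_finrank_inf_eq (⨆ i ∈ S, f.colSpan i j g) (f.colSpan j j g)
  rw [disjoint_iff.1 h3, finrank_bot, add_zero] at h4
  rw [rank_recvS, rank_recvS, Finset.iSup_insert, sup_comm, h4, h1]

lemma rank_recvS_mono (f : Strategy k m n I) {S T : Finset (Fin k)} (hST : S ⊆ T) (j : Fin k)
    (g : Chan k m n) : (f.recvS S j g).rank ≤ (f.recvS T j g).rank := by
  rw [rank_recvS, rank_recvS]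
  exact Submodule.finrank_mono (biSup_mono fun i hi => hST hi)

end Strategy

/-- **Converse inequalities for 3-user MISO BC when receiver 2 supplies delayed CSIT and
receiver 3 supplies no CSIT.** For any decodable linear coding strategy of block length
`n`, almost surely `m₁(n)/2 + m₂(n) + m₃(n) ≤ n` and `m₁(n) + m₃(n) ≤ n`. -/
theorem three_user_PDN_bounds (m n : ℕ) (hm : 3 ≤ m)
    (I : Fin 3 → CSITState) (h2 : I 1 = CSITState.D) (h3 : I 2 = CSITState.N)
    (μ : Measure ℂ) [IsProbabilityMeasure μ] (hac : μ ≪ (volume : Measure ℂ))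
    (f : Strategy 3 m n I) (hdec : f.Decodable μ) :
    ∀ᵐ _g ∂ chanMeasure 3 m n μ,
      ((f.dim 0 : ℝ) / 2 + (f.dim 1 : ℝ) + (f.dim 2 : ℝ) ≤ n) ∧
      ((f.dim 0 : ℝ) + (f.dim 2 : ℝ) ≤ n) := by
  filter_upwards [f.ae_rank_recvS_le_of_noCSIT hac {0} h3 (j := 0),
    f.ae_rank_recvS_le_of_noCSIT hac {1, 0} h3 (j := 1),
    f.ae_rank_recvS_le_two_mul_of_delayedCSIT hac {0} 0 h2,
    hdec.ae_rank_recvS_insert (j := 2) (S := {1, 0}) (by decide),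
    hdec.ae_rank_recvS_insert (j := 1) (S := {0}) (by decide),
    hdec 0] with g hN0 hN1 hD hdec2 hdec1 hdec0
  have hown : (f.recvS {0} 0 g).rank = f.dim 0 := (f.rank_recvS_singleton 0 g).trans hdec0.2
  have hmono := f.rank_recvS_mono (S := {0}) (T := {1, 0}) (by decide) 2 g
  have hle : (f.recvS {2, 1, 0} 2 g).rank ≤ n := by
    simpa using (f.recvS {2, 1, 0} 2 g).rank_le_card_height
  have hsum : f.dim 0 + 2 * f.dim 1 + 2 * f.dim 2 ≤ 2 * n := by lia
  have hsum' : f.dim 0 + f.dim 2 ≤ n := by lia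
  have hsumR : (f.dim 0 : ℝ) + 2 * f.dim 1 + 2 * f.dim 2 ≤ 2 * n := by exact_mod_cast hsum
  exact ⟨by linarith, by exact_mod_cast hsum'⟩

end
end

section
/- For the 3-user MISO BC with hybrid CSIT configuration I_1 = P, I_2 = D, I_3 = D (the PDD configuration), the degrees-of-freedom tuple (d_1, d_2, d_3) = (3/4, 1/2, 1/2) is linearly achievable. -/
open MeasureTheory Matrix Filter Topology

noncomputable section

/-- The coefficient with which receiver `i` hears, in slot `τ`, the direction that carries
antennas `0` and `a` and is orthogonal to the channel of receiver `0`. -/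
def minorAt (h : Fin 3 → Fin 4 → Fin 3 → ℂ) (i : Fin 3) (τ : Fin 4) (a : Fin 3) : ℂ :=
  h 0 τ 0 * h i τ a - h 0 τ a * h i τ 0

/-- Coefficient of symbol `s` of receiver `j` in the signal of receiver `i` in the first slot. -/
def firstObs (h : Fin 3 → Fin 4 → Fin 3 → ℂ) (i j : Fin 3) (s : ℕ) : ℂ :=
  if j = 0 then h i 0 (Fin.ofNat 3 s) else minorAt h i 0 (Fin.ofNat 3 (s + 1))

/-- The part of the first signal of receiver `i` that is interference at receiver `i`. -/
def firstInterf (h : Fin 3 → Fin 4 → Fin 3 → ℂ) (i j : Fin 3) (s : ℕ) : ℂ :=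
  if j = i then 0 else firstObs h i j s

/-- The part of the first signal of receiver `i` that carries symbols of receiver `l`. -/
def firstPart (h : Fin 3 → Fin 4 → Fin 3 → ℂ) (i l j : Fin 3) (s : ℕ) : ℂ :=
  if j = l then firstObs h i j s else 0

/-- Relative gain of the zero-forced direction at receiver `i` in slot `τ`. -/
def relGain (h : Fin 3 → Fin 4 → Fin 3 → ℂ) (i : Fin 3) (τ : Fin 4) : ℂ :=
  minorAt h i τ 1 / h i τ 0

/-- The repeated signal of the second slot as heard by receiver `2`. -/
def secondMix (h : Fin 3 → Fin 4 → Fin 3 → ℂ) (j : Fin 3) (s : ℕ) : ℂ :=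
  firstInterf h 1 j s + (1 + relGain h 2 1) * firstPart h 2 1 j s

/-- The repeated signal of the third slot as heard by receiver `1`. -/
def thirdMix (h : Fin 3 → Fin 4 → Fin 3 → ℂ) (j : Fin 3) (s : ℕ) : ℂ :=
  firstInterf h 2 j s + (1 + relGain h 1 2) * firstPart h 1 2 j s

/-- The scalar sent on antenna `0` in the last three slots. -/
def openSignal (h : Fin 3 → Fin 4 → Fin 3 → ℂ) (τ : Fin 4) (j : Fin 3) (s : ℕ) : ℂ :=
  ![0, firstInterf h 1 j s + firstPart h 2 1 j s, firstInterf h 2 j s + firstPart h 1 2 j s,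
    relGain h 1 2 * secondMix h j s + relGain h 2 1 * thirdMix h j s] τ

/-- The scalar sent along the zero-forced direction in the last three slots. -/
def forcedSignal (h : Fin 3 → Fin 4 → Fin 3 → ℂ) (τ : Fin 4) (j : Fin 3) (s : ℕ) : ℂ :=
  ![0, firstPart h 2 1 j s, firstPart h 1 2 j s, secondMix h j s] τ

/-- Precoding coefficient of symbol `s` of receiver `j` on antenna `a` in slot `τ` of a block of
four slots. -/
def blockCode (h : Fin 3 → Fin 4 → Fin 3 → ℂ) (j : Fin 3) (τ : Fin 4) (s : ℕ) (a : Fin 3) : ℂ :=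
  if τ = 0 then
    if j = 0 then (if a = Fin.ofNat 3 s then 1 else 0)
    else if a = 0 then -h 0 0 (Fin.ofNat 3 (s + 1))
    else if a = Fin.ofNat 3 (s + 1) then h 0 0 0 else 0
  else ![openSignal h τ j s - h 0 τ 1 * forcedSignal h τ j s, h 0 τ 0 * forcedSignal h τ j s, 0] a

/-- Coefficient of symbol `s` of receiver `i` in the signal of receiver `j` in slot `τ`. -/
def blockRecv (h : Fin 3 → Fin 4 → Fin 3 → ℂ) (j : Fin 3) (τ : Fin 4) (i : Fin 3) (s : ℕ) : ℂ :=
  ∑ a, h j τ a * blockCode h i τ s a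

/-- Signal of receiver `j` in slot `τ` of a block when the symbols are `α`, `β`, `γ`. -/
def blockSignal (h : Fin 3 → Fin 4 → Fin 3 → ℂ) (j : Fin 3) (τ : Fin 4)
    (α : Fin 3 → ℂ) (β γ : Fin 2 → ℂ) : ℂ :=
  ∑ s : Fin 3, blockRecv h j τ 0 s * α s + ∑ s : Fin 2, blockRecv h j τ 1 s * β s
    + ∑ s : Fin 2, blockRecv h j τ 2 s * γ s

/-- Determinant of the channels of the three receivers in the first slot. -/
def firstDet (h : Fin 3 → Fin 4 → Fin 3 → ℂ) : ℂ := (Matrix.of fun i a => h i 0 a).det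

/-- The nondegeneracy conditions on the channels of a block under which all receivers decode. -/
structure GoodBlock (h : Fin 3 → Fin 4 → Fin 3 → ℂ) : Prop where
  entry : ∀ j τ, h j τ 0 ≠ 0
  minor : ∀ i j τ, i < j → h i τ 0 * h j τ 1 - h i τ 1 * h j τ 0 ≠ 0
  det : firstDet h ≠ 0
  last : h 0 3 0 * h 1 2 0 * h 1 3 1
    + (h 1 3 0 * minorAt h 1 2 1 - h 0 3 1 * h 1 3 0 * h 1 2 0) ≠ 0

section Decoding

variable (h : Fin 3 → Fin 4 → Fin 3 → ℂ) (j : Fin 3) (α : Fin 3 → ℂ) (β γ : Fin 2 → ℂ)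

/-- Contribution of the symbols of receiver `0` to the first signal of receiver `i`. -/
def privateForm (i : Fin 3) : ℂ := ∑ s, h i 0 s * α s

/-- Contribution of a pair of zero-forced symbols to the first signal of receiver `i`. -/
def forcedForm (i : Fin 3) (β : Fin 2 → ℂ) : ℂ :=
  minorAt h i 0 1 * β 0 + minorAt h i 0 2 * β 1

lemma blockSignal_zero : blockSignal h j 0 α β γ
    = privateForm h α j + forcedForm h j β + forcedForm h j γ := by
  simp [blockSignal, blockRecv, blockCode, privateForm, forcedForm, minorAt, Fin.sum_univ_succ,
    Fin.ofNat]
  ring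

lemma blockSignal_one : blockSignal h j 1 α β γ
    = h j 1 0 * (privateForm h α 1 + forcedForm h 1 γ + forcedForm h 2 β)
      + minorAt h j 1 1 * forcedForm h 2 β := by
  simp [blockSignal, blockRecv, blockCode, privateForm, forcedForm, minorAt, Fin.sum_univ_succ,
    Fin.ofNat, openSignal, forcedSignal, firstInterf, firstPart, firstObs]
  ring

lemma blockSignal_two : blockSignal h j 2 α β γ
    = h j 2 0 * (privateForm h α 2 + forcedForm h 2 β + forcedForm h 1 γ)
      + minorAt h j 2 1 * forcedForm h 1 γ := by
  simp [blockSignal, blockRecv, blockCode, privateForm, forcedForm, minorAt, Fin.sum_univ_succ,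
    Fin.ofNat, openSignal, forcedSignal, firstInterf, firstPart, firstObs]
  ring

lemma blockSignal_three : blockSignal h j 3 α β γ
    = (h j 3 0 * relGain h 1 2 + minorAt h j 3 1)
        * (privateForm h α 1 + forcedForm h 1 γ + (1 + relGain h 2 1) * forcedForm h 2 β)
      + h j 3 0 * relGain h 2 1
        * (privateForm h α 2 + forcedForm h 2 β + (1 + relGain h 1 2) * forcedForm h 1 γ) := by
  generalize hk : relGain h 1 2 = k
  generalize ht : relGain h 2 1 = t
  simp [blockSignal, blockRecv, blockCode, privateForm, forcedForm, minorAt, Fin.sum_univ_succ,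
    Fin.ofNat, openSignal, forcedSignal, secondMix, thirdMix, firstInterf, firstPart, firstObs,
    hk, ht]
  ring

variable {h α β γ}

lemma minorAt_one_ne_zero (hg : GoodBlock h) {j : Fin 3} (hj : 0 < j) (τ : Fin 4) :
    minorAt h j τ 1 ≠ 0 :=
  hg.minor 0 j τ hj

lemma relGain_ne_zero (hg : GoodBlock h) {j : Fin 3} (hj : 0 < j) (τ : Fin 4) :
    relGain h j τ ≠ 0 :=
  div_ne_zero (minorAt_one_ne_zero hg hj τ) (hg.entry j τ)

lemma relGain_sub_ne_zero (hg : GoodBlock h) (τ : Fin 4) :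
    relGain h 2 τ - relGain h 1 τ ≠ 0 := by
  have h1 := hg.entry 1 τ
  have h2 := hg.entry 2 τ
  have key : relGain h 2 τ - relGain h 1 τ
      = h 0 τ 0 * (h 1 τ 0 * h 2 τ 1 - h 1 τ 1 * h 2 τ 0) / (h 1 τ 0 * h 2 τ 0) := by
    unfold relGain minorAt
    field_simp
    ring
  rw [key]
  exact div_ne_zero (mul_ne_zero (hg.entry 0 τ) (hg.minor 1 2 τ (by decide))) (mul_ne_zero h1 h2)

lemma forcedForm_injective (hg : GoodBlock h) {β : Fin 2 → ℂ}
    (h1 : forcedForm h 1 β = 0) (h2 : forcedForm h 2 β = 0) : β = 0 := by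
  have hD : h 0 0 0 * firstDet h ≠ 0 := mul_ne_zero (hg.entry 0 0) hg.det
  have hdet : h 0 0 0 * firstDet h
      = minorAt h 1 0 1 * minorAt h 2 0 2 - minorAt h 1 0 2 * minorAt h 2 0 1 := by
    simp [firstDet, Matrix.det_fin_three, minorAt]
    ring
  unfold forcedForm at h1 h2
  funext s
  fin_cases s
  · refine (mul_eq_zero.1 (?_ : h 0 0 0 * firstDet h * β 0 = 0)).resolve_left hD
    rw [hdet]
    linear_combination minorAt h 2 0 2 * h1 - minorAt h 1 0 2 * h2
  · refine (mul_eq_zero.1 (?_ : h 0 0 0 * firstDet h * β 1 = 0)).resolve_left hD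
    rw [hdet]
    linear_combination minorAt h 1 0 1 * h2 - minorAt h 2 0 1 * h1

lemma decode_zero (hg : GoodBlock h) (hz : ∀ τ, blockSignal h 0 τ α β γ = 0) : α = 0 := by
  have e0 := hz 0
  have e1 := hz 1
  have e2 := hz 2
  have e3 := hz 3
  rw [blockSignal_zero] at e0
  rw [blockSignal_one] at e1
  rw [blockSignal_two] at e2
  rw [blockSignal_three] at e3
  have hm (τ a) : minorAt h 0 τ a = 0 := by unfold minorAt; ring
  have hk := relGain_ne_zero hg (j := 1) (by decide) 2
  have ht := relGain_ne_zero hg (j := 2) (by decide) 1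
  have hf (β) : forcedForm h 0 β = 0 := by simp [forcedForm, hm]
  simp only [hm, hf, zero_mul, add_zero, mul_eq_zero, hg.entry, false_or] at e0 e1 e2 e3
  generalize relGain h 1 2 = k at *
  generalize relGain h 2 1 = t at *
  have e3' : h 0 3 0 * (k * t * (forcedForm h 1 γ + forcedForm h 2 β)) = 0 := by
    linear_combination e3 - h 0 3 0 * k * e1 - h 0 3 0 * t * e2
  have hI : forcedForm h 1 γ + forcedForm h 2 β = 0 := by
    simpa [hg.entry, hk, ht] using e3'
  have f1 : privateForm h α 1 = 0 := by linear_combination e1 - hI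
  have f2 : privateForm h α 2 = 0 := by linear_combination e2 - hI
  refine Matrix.eq_zero_of_mulVec_eq_zero hg.det ?_
  funext i
  fin_cases i
  exacts [e0, f1, f2]

lemma decode_one (hg : GoodBlock h) (hz : ∀ τ, blockSignal h 1 τ α β γ = 0) : β = 0 := by
  have e0 := hz 0
  have e1 := hz 1
  have e2 := hz 2
  have e3 := hz 3
  rw [blockSignal_zero] at e0
  rw [blockSignal_one] at e1
  rw [blockSignal_two] at e2
  rw [blockSignal_three] at e3
  have hp1 := hg.entry 1 1
  have hp2 := hg.entry 1 2
  have hm1 : minorAt h 1 1 1 = h 1 1 0 * relGain h 1 1 := by unfold relGain; field_simp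
  have hm2 : minorAt h 1 2 1 = h 1 2 0 * relGain h 1 2 := by unfold relGain; field_simp
  have hl : h 1 3 0 * relGain h 1 2 + minorAt h 1 3 1 ≠ 0 := by
    intro h0
    apply hg.last
    rw [hm2]
    unfold minorAt at h0
    linear_combination h 1 2 0 * h0
  have ht := relGain_sub_ne_zero hg 1
  rw [hm1] at e1
  rw [hm2] at e2
  generalize relGain h 1 2 = k at *
  generalize relGain h 2 1 = t at *
  generalize relGain h 1 1 = t' at *
  have f1 : privateForm h α 1 + forcedForm h 1 γ + (1 + t') * forcedForm h 2 β = 0 :=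
    (mul_eq_zero.1 (by linear_combination e1)).resolve_left hp1
  have f2 : privateForm h α 2 + forcedForm h 2 β + (1 + k) * forcedForm h 1 γ = 0 :=
    (mul_eq_zero.1 (by linear_combination e2)).resolve_left hp2
  have f3 : privateForm h α 1 + forcedForm h 1 γ + (1 + t) * forcedForm h 2 β = 0 :=
    (mul_eq_zero.1 (by linear_combination e3 - h 1 3 0 * t * f2)).resolve_left hl
  have g2 : forcedForm h 2 β = 0 :=
    (mul_eq_zero.1 (by linear_combination f3 - f1)).resolve_left ht
  refine forcedForm_injective hg ?_ g2
  linear_combination e0 - f3 + (1 + t) * g2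

lemma decode_two (hg : GoodBlock h) (hz : ∀ τ, blockSignal h 2 τ α β γ = 0) : γ = 0 := by
  have e0 := hz 0
  have e1 := hz 1
  have e2 := hz 2
  have e3 := hz 3
  rw [blockSignal_zero] at e0
  rw [blockSignal_one] at e1
  rw [blockSignal_two] at e2
  rw [blockSignal_three] at e3
  have hp1 := hg.entry 2 1
  have hp2 := hg.entry 2 2
  have hp3 := hg.entry 2 3
  have hm1 : minorAt h 2 1 1 = h 2 1 0 * relGain h 2 1 := by unfold relGain; field_simp
  have hm2 : minorAt h 2 2 1 = h 2 2 0 * relGain h 2 2 := by unfold relGain; field_simp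
  have ht := relGain_ne_zero hg (j := 2) (by decide) 1
  have hk := relGain_sub_ne_zero hg 2
  rw [hm1] at e1
  rw [hm2] at e2
  generalize relGain h 1 2 = k at *
  generalize relGain h 2 1 = t at *
  generalize relGain h 2 2 = k' at *
  have f1 : privateForm h α 1 + forcedForm h 1 γ + (1 + t) * forcedForm h 2 β = 0 :=
    (mul_eq_zero.1 (by linear_combination e1)).resolve_left hp1
  have f2 : privateForm h α 2 + forcedForm h 2 β + (1 + k') * forcedForm h 1 γ = 0 :=
    (mul_eq_zero.1 (by linear_combination e2)).resolve_left hp2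
  have f3 : privateForm h α 2 + forcedForm h 2 β + (1 + k) * forcedForm h 1 γ = 0 :=
    (mul_eq_zero.1 (by
      linear_combination e3 - (h 2 3 0 * k + minorAt h 2 3 1) * f1)).resolve_left
      (mul_ne_zero hp3 ht)
  have g1 : forcedForm h 1 γ = 0 :=
    (mul_eq_zero.1 (by linear_combination f2 - f3)).resolve_left hk
  refine forcedForm_injective hg g1 ?_
  linear_combination e0 - f3 + (1 + k) * g1

end Decoding

section Generic

lemma pi_eq_zero_of_update {ι : Type*} [Fintype ι] [DecidableEq ι] {X : ι → Type*}
    [∀ i, MeasurableSpace (X i)] (ν : ∀ i, Measure (X i)) [∀ i, SigmaFinite (ν i)]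
    {S : Set (∀ i, X i)} (hS : MeasurableSet S) (i : ι)
    (h : ∀ x, ν i {z | Function.update x i z ∈ S} = 0) : Measure.pi ν S = 0 := by
  have key : ∫⁻ x, S.indicator 1 x ∂Measure.pi ν = ∫⁻ x, (0 : (∀ i, X i) → ENNReal) x ∂Measure.pi ν := by
    refine lintegral_eq_of_lmarginal_eq {i} (measurable_one.indicator hS) measurable_zero ?_
    rw [lmarginal_singleton, lmarginal_singleton]
    funext x
    have hm : MeasurableSet {z | Function.update x i z ∈ S} := measurable_update x hS
    have : (fun z => S.indicator (1 : (∀ i, X i) → ENNReal) (Function.update x i z))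
        = {z | Function.update x i z ∈ S}.indicator 1 := by
      rfl
    simp [this, lintegral_indicator_one hm, h x]
  simpa [lintegral_indicator_one hS] using key

variable {k m n : ℕ} {μ : Measure ℂ} [IsProbabilityMeasure μ]

/-- The channel realization `g` with the coefficient at `(j, t, a)` replaced by `z`. -/
def updateCoeff (g : Chan k m n) (j : Fin k) (t : Fin n) (a : Fin m) (z : ℂ) : Chan k m n :=
  Function.update g j (Function.update (g j) t (Function.update (g j t) a z))

lemma updateCoeff_apply (g : Chan k m n) (j i : Fin k) (t s : Fin n) (a b : Fin m) (z : ℂ) :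
    updateCoeff g j t a z i s b = if i = j ∧ s = t ∧ b = a then z else g i s b := by
  unfold updateCoeff
  by_cases hi : i = j
  · subst hi
    by_cases hs : s = t
    · subst hs
      by_cases hb : b = a
      · subst hb; simp
      · simp [hb]
    · simp [hs]
  · simp [hi]

lemma chanMeasure_eq_zero_of_update {S : Set (Chan k m n)} (hS : MeasurableSet S)
    (j : Fin k) (t : Fin n) (a : Fin m)
    (h : ∀ g, μ {z | updateCoeff g j t a z ∈ S} = 0) : chanMeasure k m n μ S = 0 := by
  refine pi_eq_zero_of_update _ hS j fun g => ?_
  refine pi_eq_zero_of_update _ (measurable_update g hS) t fun x => ?_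
  refine pi_eq_zero_of_update _ (measurable_update x (measurable_update g hS)) a fun y => ?_
  have := h (Function.update g j (Function.update x t y))
  simpa [updateCoeff] using this

/-- An expression that is affine in one channel coefficient, with almost surely nonzero slope,
is almost surely nonzero. -/
lemma ae_affine_ne_zero (hac : μ ≪ (volume : Measure ℂ)) (A B : Chan k m n → ℂ)
    (hA : Measurable A) (hB : Measurable B) (j : Fin k) (t : Fin n) (a : Fin m)
    (hAu : ∀ g z, A (updateCoeff g j t a z) = A g)
    (hBu : ∀ g z, B (updateCoeff g j t a z) = B g)
    (hA0 : ∀ᵐ g ∂chanMeasure k m n μ, A g ≠ 0) :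
    ∀ᵐ g ∂chanMeasure k m n μ, A g * g j t a + B g ≠ 0 := by
  have hcoord : Measurable fun g : Chan k m n => g j t a := by fun_prop
  have hS : MeasurableSet {g : Chan k m n | A g ≠ 0 ∧ A g * g j t a + B g = 0} :=
    (hA (measurableSet_singleton 0)).compl.inter
      (((hA.mul hcoord).add hB) (measurableSet_singleton 0))
  have hnull : ∀ᵐ g ∂chanMeasure k m n μ, ¬ (A g ≠ 0 ∧ A g * g j t a + B g = 0) := by
    rw [ae_iff]
    simp only [not_not]
    refine chanMeasure_eq_zero_of_update hS j t a fun g => hac ?_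
    refine Set.Subsingleton.measure_zero ?_ _
    rintro z ⟨hz, hz0⟩ w ⟨-, hw0⟩
    rw [hAu] at hz
    rw [hAu, hBu, updateCoeff_apply, if_pos ⟨rfl, rfl, rfl⟩] at hz0 hw0
    exact mul_left_cancel₀ hz (by linear_combination hz0 - hw0)
  filter_upwards [hA0, hnull] with g h1 h2 h3
  exact h2 ⟨h1, h3⟩

/-- The channels seen in the slots `slot τ` through the antennas `ant a`. -/
def restrictChan (slot : Fin 4 → Fin n) (ant : Fin 3 → Fin m) (g : Chan 3 m n) :
    Fin 3 → Fin 4 → Fin 3 → ℂ :=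
  fun j τ a => g j (slot τ) (ant a)

lemma ae_goodBlock (hac : μ ≪ (volume : Measure ℂ)) {slot : Fin 4 → Fin n} {ant : Fin 3 → Fin m}
    (hslot : slot.Injective) (hant : ant.Injective) :
    ∀ᵐ g ∂chanMeasure 3 m n μ, GoodBlock (restrictChan slot ant g) := by
  have hentry (j : Fin 3) (t : Fin n) (a : Fin m) :
      ∀ᵐ g ∂chanMeasure 3 m n μ, g j t a ≠ 0 := by
    have := ae_affine_ne_zero (k := 3) hac (fun _ => 1) (fun _ => 0) measurable_const
      measurable_const j t a (by simp) (by simp) (by simp)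
    simpa using this
  have hminor (i j : Fin 3) (hij : i < j) (t : Fin n) : ∀ᵐ g ∂chanMeasure 3 m n μ,
      g i t (ant 0) * g j t (ant 1) - g i t (ant 1) * g j t (ant 0) ≠ 0 := by
    have := ae_affine_ne_zero (k := 3) hac (fun g => g i t (ant 0))
      (fun g => -(g i t (ant 1) * g j t (ant 0))) (by fun_prop) (by fun_prop) j t (ant 1)
      (by simp [updateCoeff_apply, hij.ne]) (by simp [updateCoeff_apply, hij.ne, hant.eq_iff])
      (hentry i t (ant 0))
    simpa [sub_eq_add_neg] using this
  have hdet : ∀ᵐ g ∂chanMeasure 3 m n μ, firstDet (restrictChan slot ant g) ≠ 0 := by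
    have := ae_affine_ne_zero (k := 3) hac
      (fun g => g 0 (slot 0) (ant 0) * g 1 (slot 0) (ant 1)
        - g 0 (slot 0) (ant 1) * g 1 (slot 0) (ant 0))
      (fun g => -(g 0 (slot 0) (ant 0) * g 1 (slot 0) (ant 2) * g 2 (slot 0) (ant 1))
        + g 0 (slot 0) (ant 1) * g 1 (slot 0) (ant 2) * g 2 (slot 0) (ant 0)
        + g 0 (slot 0) (ant 2) * g 1 (slot 0) (ant 0) * g 2 (slot 0) (ant 1)
        - g 0 (slot 0) (ant 2) * g 1 (slot 0) (ant 1) * g 2 (slot 0) (ant 0))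
      (by fun_prop) (by fun_prop) 2 (slot 0) (ant 2)
      (by simp [updateCoeff_apply]) (by simp [updateCoeff_apply, hant.eq_iff])
      (hminor 0 1 (by decide) (slot 0))
    filter_upwards [this] with g hg h0
    apply hg
    simp only [firstDet, restrictChan, Matrix.det_fin_three, Matrix.of_apply] at h0
    linear_combination h0
  have hlast : ∀ᵐ g ∂chanMeasure 3 m n μ,
      g 0 (slot 3) (ant 0) * g 1 (slot 2) (ant 0) * g 1 (slot 3) (ant 1)
        + (g 1 (slot 3) (ant 0) * (g 0 (slot 2) (ant 0) * g 1 (slot 2) (ant 1)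
            - g 0 (slot 2) (ant 1) * g 1 (slot 2) (ant 0))
          - g 0 (slot 3) (ant 1) * g 1 (slot 3) (ant 0) * g 1 (slot 2) (ant 0)) ≠ 0 := by
    refine ae_affine_ne_zero (k := 3) hac
      (fun g => g 0 (slot 3) (ant 0) * g 1 (slot 2) (ant 0)) (fun g =>
        (g 1 (slot 3) (ant 0) * (g 0 (slot 2) (ant 0) * g 1 (slot 2) (ant 1)
            - g 0 (slot 2) (ant 1) * g 1 (slot 2) (ant 0))
          - g 0 (slot 3) (ant 1) * g 1 (slot 3) (ant 0) * g 1 (slot 2) (ant 0)))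
      (by fun_prop) (by fun_prop) 1 (slot 3) (ant 1)
      (by simp [updateCoeff_apply, hslot.eq_iff])
      (by simp [updateCoeff_apply, hslot.eq_iff, hant.eq_iff]) ?_
    filter_upwards [hentry 0 (slot 3) (ant 0), hentry 1 (slot 2) (ant 0)] with g h1 h2
    exact mul_ne_zero h1 h2
  have hentry' : ∀ᵐ g ∂chanMeasure 3 m n μ, ∀ j τ, g j (slot τ) (ant 0) ≠ 0 :=
    ae_all_iff.2 fun j => ae_all_iff.2 fun τ => hentry j (slot τ) (ant 0)
  have hminor' : ∀ᵐ g ∂chanMeasure 3 m n μ, ∀ i j τ, i < j →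
      g i (slot τ) (ant 0) * g j (slot τ) (ant 1)
        - g i (slot τ) (ant 1) * g j (slot τ) (ant 0) ≠ 0 :=
    ae_all_iff.2 fun i => ae_all_iff.2 fun j => ae_all_iff.2 fun τ => ae_all_iff.2 fun hij =>
      hminor i j hij (slot τ)
  filter_upwards [hentry', hminor', hdet, hlast] with g h1 h2 h3 h4
  exact ⟨h1, h2, h3, h4⟩

end Generic

section Rank

variable {k m n : ℕ} {I : Fin k → CSITState}

lemma recvS_apply (f : Strategy k m n I) (S : Finset (Fin k)) (j : Fin k) (g : Chan k m n)
    (t : Fin n) (c : (i : {x // x ∈ S}) × Fin (f.dim i.1)) :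
    f.recvS S j g t c = (_root_.blockDiag (g j) * f.Vn c.1.1 g) t c.2 := rfl

lemma blockDiag_mul_Vn_apply (f : Strategy k m n I) (i : Fin k) (g : Chan k m n)
    (x : Fin n → Fin m → ℂ) (t : Fin n) (c : Fin (f.dim i)) :
    (_root_.blockDiag x * f.Vn i g) t c = ∑ a, x t a * f.pre i t g a c := by
  simp [Matrix.mul_apply, _root_.blockDiag, Strategy.Vn, Fintype.sum_prod_type, ite_mul]

/-- If the symbols of receiver `j` vanish whenever its received signal does, then its rank
condition for decodability holds. -/
lemma rank_condition_of_kernel (f : Strategy k m n I) (j : Fin k) (g : Chan k m n)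
    (hker : ∀ x : (i : Fin k) → Fin (f.dim i) → ℂ,
      (∑ i, (_root_.blockDiag (g j) * f.Vn i g) *ᵥ x i = 0) → x j = 0) :
    (f.recvS Finset.univ j g).rank - (f.recvS (Finset.univ.erase j) j g).rank
        = (f.recv1 j g).rank ∧ (f.recv1 j g).rank = f.dim j := by
  have hinj : LinearIndependent ℂ (f.recv1 j g).col := by
    rw [← Matrix.mulVec_injective_iff, ← Matrix.coe_mulVecLin, injective_iff_map_eq_zero]
    intro y hy
    have := hker (Pi.single j y) ?_
    · simpa using this
    · rw [Finset.sum_eq_single j]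
      · simpa using (show (_root_.blockDiag (g j) * f.Vn j g) *ᵥ y = 0 from hy)
      · intro i _ hij
        simp [hij]
      · simp
  have hrank : (f.recv1 j g).rank = f.dim j := by
    simpa using hinj.rank_matrix
  refine ⟨?_, hrank⟩
  have hspan : Submodule.span ℂ (Set.range (f.recvS Finset.univ j g).col)
      = Submodule.span ℂ (Set.range (f.recv1 j g).col)
        ⊔ Submodule.span ℂ (Set.range (f.recvS (Finset.univ.erase j) j g).col) := by
    rw [← Submodule.span_union]
    congr 1
    ext v
    constructor
    · rintro ⟨⟨⟨i, hi⟩, c⟩, rfl⟩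
      by_cases hij : i = j
      · subst hij
        exact Or.inl ⟨c, rfl⟩
      · exact Or.inr ⟨⟨⟨i, by simp [hij]⟩, c⟩, rfl⟩
    · rintro (⟨c, rfl⟩ | ⟨⟨⟨i, hi⟩, c⟩, rfl⟩)
      · exact ⟨⟨⟨j, by simp⟩, c⟩, rfl⟩
      · exact ⟨⟨⟨i, by simp⟩, c⟩, rfl⟩
  have hdisj : Disjoint (Submodule.span ℂ (Set.range (f.recv1 j g).col))
      (Submodule.span ℂ (Set.range (f.recvS (Finset.univ.erase j) j g).col)) := by
    rw [← Matrix.range_mulVecLin, ← Matrix.range_mulVecLin, Submodule.disjoint_def]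
    rintro v ⟨y, rfl⟩ ⟨w, hw⟩
    simp only [Matrix.mulVecLin_apply] at hw ⊢
    let x : (i : Fin k) → Fin (f.dim i) → ℂ := fun i =>
      if h : i = j then h ▸ y else fun c => -w ⟨⟨i, by simp [h]⟩, c⟩
    have hxj : x j = y := by simp [x]
    have hx : ∑ i, (_root_.blockDiag (g j) * f.Vn i g) *ᵥ x i = 0 := by
      rw [← Finset.add_sum_erase _ _ (Finset.mem_univ j), hxj]
      have hrest : ∑ i ∈ Finset.univ.erase j, (_root_.blockDiag (g j) * f.Vn i g) *ᵥ x i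
          = -(f.recvS (Finset.univ.erase j) j g *ᵥ w) := by
        funext t
        rw [Finset.sum_apply, ← Finset.sum_coe_sort, Pi.neg_apply, Matrix.mulVec, dotProduct,
          Fintype.sum_sigma, ← Finset.sum_neg_distrib]
        refine Finset.sum_congr rfl fun i _ => ?_
        have hi : (i : Fin k) ≠ j := (Finset.mem_erase.1 i.2).1
        simp [Matrix.mulVec, dotProduct, x, hi, recvS_apply]
      rw [hrest, hw]
      exact add_neg_cancel _
    have := hker x hx
    rw [hxj] at this
    simp [this]
  rw [Matrix.rank_eq_finrank_span_cols (f.recvS Finset.univ j g),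
    Matrix.rank_eq_finrank_span_cols (f.recvS (Finset.univ.erase j) j g),
    Matrix.rank_eq_finrank_span_cols (f.recv1 j g), hspan]
  have := Submodule.finrank_sup_add_finrank_inf_eq
    (Submodule.span ℂ (Set.range (f.recv1 j g).col))
    (Submodule.span ℂ (Set.range (f.recvS (Finset.univ.erase j) j g).col))
  rw [hdisj.eq_bot, finrank_bot] at this
  omega

end Rank

lemma blockCode_congr {h h' : Fin 3 → Fin 4 → Fin 3 → ℂ} {τ : Fin 4}
    (hP : ∀ σ ≤ τ, h 0 σ = h' 0 σ) (hD : ∀ j, j ≠ 0 → ∀ σ < τ, h j σ = h' j σ) (j : Fin 3) :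
    blockCode h j τ = blockCode h' j τ := by
  funext s a
  have hall : ∀ j, ∀ σ < τ, h j σ = h' j σ := by
    intro j σ hσ
    by_cases hj : j = 0
    · subst hj; exact hP σ hσ.le
    · exact hD j hj σ hσ
  have hτ := hP τ le_rfl
  by_cases h0 : τ = 0
  · subst h0
    simp [blockCode, hτ]
  · have hfirst : ∀ i, h i 0 = h' i 0 := fun i => hall i 0 (Fin.pos_iff_ne_zero.2 h0)
    have hgain : ∀ i, ∀ σ < τ, relGain h i σ = relGain h' i σ := by
      intro i σ hσ
      simp [relGain, minorAt, hall _ σ hσ]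
    have hobs : ∀ i, firstObs h i = firstObs h' i := by
      intro i
      funext j s
      simp [firstObs, minorAt, hfirst]
    have hsig : openSignal h τ j s = openSignal h' τ j s
        ∧ forcedSignal h τ j s = forcedSignal h' τ j s := by
      fin_cases τ
      · exact absurd rfl h0
      · simp [openSignal, forcedSignal, firstInterf, firstPart, hobs]
      · simp [openSignal, forcedSignal, firstInterf, firstPart, hobs]
      · have h1 := hgain 2 1 (by decide)
        have h2 := hgain 1 2 (by decide)
        simp [openSignal, forcedSignal, secondMix, thirdMix, firstInterf, firstPart, hobs, h1, h2]
    simp [blockCode, h0, hτ, hsig]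

lemma measurable_blockCode {Ω : Type*} [MeasurableSpace Ω] {H : Ω → Fin 3 → Fin 4 → Fin 3 → ℂ}
    (hH : ∀ j τ a, Measurable fun ω => H ω j τ a) (j : Fin 3) (τ : Fin 4) (s : ℕ) (a : Fin 3) :
    Measurable fun ω => blockCode (H ω) j τ s a := by
  have hminor : ∀ i σ b, Measurable fun ω => minorAt (H ω) i σ b := by
    intro i σ b
    unfold minorAt
    fun_prop
  have hgain : ∀ i σ, Measurable fun ω => relGain (H ω) i σ := fun i σ =>
    (hminor i σ 1).div (hH i σ 0)
  have hobs : ∀ i j s, Measurable fun ω => firstObs (H ω) i j s := by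
    intro i j s
    unfold firstObs
    split_ifs <;> fun_prop
  have hinterf : ∀ i j s, Measurable fun ω => firstInterf (H ω) i j s := by
    intro i j s
    unfold firstInterf
    split_ifs <;> fun_prop
  have hpart : ∀ i l j s, Measurable fun ω => firstPart (H ω) i l j s := by
    intro i l j s
    unfold firstPart
    split_ifs <;> fun_prop
  have hsecond : ∀ j s, Measurable fun ω => secondMix (H ω) j s := by
    intro j s
    unfold secondMix
    fun_prop
  have hthird : ∀ j s, Measurable fun ω => thirdMix (H ω) j s := by
    intro j s
    unfold thirdMix
    fun_prop
  have hopen : ∀ σ, Measurable fun ω => openSignal (H ω) σ j s := by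
    intro σ
    unfold openSignal
    fin_cases σ <;> simp <;> fun_prop
  have hforced : ∀ σ, Measurable fun ω => forcedSignal (H ω) σ j s := by
    intro σ
    unfold forcedSignal
    fin_cases σ <;> simp <;> fun_prop
  unfold blockCode
  split_ifs
  all_goals fun_prop

/-- Slot `τ` of the `b`-th block of four slots. -/
def blockSlot {n : ℕ} (b : Fin (n / 4)) (τ : Fin 4) : Fin n := ⟨4 * b + τ, by omega⟩

lemma blockSlot_injective {n : ℕ} (b : Fin (n / 4)) : (blockSlot b).Injective := by
  intro σ τ h
  simpa [blockSlot, Fin.ext_iff] using h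

/-- Channels of a block, through the first three antennas. -/
def blockChan {m n : ℕ} (hm : 3 ≤ m) (b : Fin (n / 4)) (g : Chan 3 m n) :
    Fin 3 → Fin 4 → Fin 3 → ℂ :=
  restrictChan (blockSlot b) (Fin.castLE hm) g

/-- The number of symbols of each receiver in a block. -/
def blockDim : Fin 3 → ℕ := ![3, 2, 2]

/-- The strategy that applies the block code in each of the first `n / 4` blocks of four slots. -/
def pddStrategy {m : ℕ} (hm : 3 ≤ m) (n : ℕ) :
    Strategy 3 m n ![CSITState.P, CSITState.D, CSITState.D] where
  dim j := n / 4 * blockDim j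
  pre j t g := Matrix.of fun a c =>
    if (t : ℕ) / 4 = c.divNat then
      if ha : (a : ℕ) < 3 then
        blockCode (blockChan hm c.divNat g) j (Fin.ofNat 4 t) c.modNat ⟨a, ha⟩
      else 0
    else 0
  meas j t a c := by
    simp only [Matrix.of_apply]
    split_ifs
    · exact measurable_blockCode (fun i τ b => by unfold blockChan restrictChan; fun_prop) _ _ _ _
    · exact measurable_const
    · exact measurable_const
  causal j t g g' hP hD := by
    ext a c
    simp only [Matrix.of_apply]
    split_ifs with hb ha
    · refine congrFun (congrFun (blockCode_congr ?_ ?_ j) _) _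
      · intro σ hσ
        funext b
        refine congrFun (hP 0 rfl _ ?_) _
        simp only [Fin.le_def, Fin.ofNat, blockSlot] at hσ ⊢
        omega
      · intro i hi σ hσ
        funext b
        refine congrFun (hD i ?_ _ ?_) _
        · fin_cases i
          exacts [absurd rfl hi, rfl, rfl]
        · simp only [Fin.lt_def, Fin.ofNat, blockSlot] at hσ ⊢
          omega
    · rfl
    · rfl

lemma pddStrategy_pre_blockSlot {m n : ℕ} (hm : 3 ≤ m) (j : Fin 3) (b b' : Fin (n / 4))
    (τ : Fin 4) (s : Fin (blockDim j)) (g : Chan 3 m n) (a : Fin m) :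
    (pddStrategy hm n).pre j (blockSlot b τ) g a (finProdFinEquiv (b', s))
      = if b' = b then
          if ha : (a : ℕ) < 3 then blockCode (blockChan hm b g) j τ s ⟨a, ha⟩ else 0
        else 0 := by
  have h1 : (finProdFinEquiv (b', s)).divNat = b' :=
    congrArg Prod.fst (finProdFinEquiv.symm_apply_apply (b', s))
  have h2 : (finProdFinEquiv (b', s)).modNat = s :=
    congrArg Prod.snd (finProdFinEquiv.symm_apply_apply (b', s))
  have h3 : (blockSlot b τ : ℕ) / 4 = b := by simp only [blockSlot]; omega
  have h4 : Fin.ofNat 4 (blockSlot b τ : ℕ) = τ := by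
    ext
    simp only [blockSlot, Fin.ofNat]
    omega
  simp only [pddStrategy, Matrix.of_apply, h1, h2, h3, h4]
  by_cases hb : b' = b
  · subst hb; simp
  · have : (b : ℕ) ≠ b' := fun h => hb (Fin.ext h.symm)
    simp [hb, this]

lemma sum_first_antennas {m : ℕ} (hm : 3 ≤ m) (x : Fin m → ℂ) (y : Fin 3 → ℂ) :
    ∑ a : Fin m, x a * (if ha : (a : ℕ) < 3 then y ⟨a, ha⟩ else 0)
      = ∑ a : Fin 3, x (Fin.castLE hm a) * y a := by
  obtain ⟨k, rfl⟩ := Nat.exists_eq_add_of_le hm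
  rw [Fin.sum_univ_add]
  simp [Fin.castAdd]

lemma pddStrategy_signal {m n : ℕ} (hm : 3 ≤ m) (j : Fin 3) (g : Chan 3 m n)
    (x : (i : Fin 3) → Fin (n / 4 * blockDim i) → ℂ) (b : Fin (n / 4)) (τ : Fin 4) :
    (∑ i, (_root_.blockDiag (g j) * (pddStrategy hm n).Vn i g) *ᵥ x i) (blockSlot b τ)
      = blockSignal (blockChan hm b g) j τ (fun s => x 0 (finProdFinEquiv (b, s)))
          (fun s => x 1 (finProdFinEquiv (b, s))) (fun s => x 2 (finProdFinEquiv (b, s))) := by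
  have hpart (i : Fin 3) :
      ((_root_.blockDiag (g j) * (pddStrategy hm n).Vn i g) *ᵥ x i) (blockSlot b τ)
        = ∑ s : Fin (blockDim i),
            blockRecv (blockChan hm b g) j τ i s * x i (finProdFinEquiv (b, s)) := by
    have hcol (b' : Fin (n / 4)) (s : Fin (blockDim i)) :
        (_root_.blockDiag (g j) * (pddStrategy hm n).Vn i g) (blockSlot b τ) (finProdFinEquiv (b', s))
          = if b' = b then blockRecv (blockChan hm b g) j τ i s else 0 := by
      refine (blockDiag_mul_Vn_apply (pddStrategy hm n) i g (g j) (blockSlot b τ)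
        (finProdFinEquiv (b', s) : Fin (n / 4 * blockDim i))).trans ?_
      refine (Finset.sum_congr rfl fun a _ => congrArg (g j (blockSlot b τ) a * ·)
        (pddStrategy_pre_blockSlot hm i b b' τ s g a)).trans ?_
      split_ifs with hb
      · exact sum_first_antennas hm _ _
      · simp
    change ∑ c : Fin (n / 4 * blockDim i),
      (_root_.blockDiag (g j) * (pddStrategy hm n).Vn i g) (blockSlot b τ) c * x i c = _
    refine (Equiv.sum_comp (finProdFinEquiv (m := n / 4) (n := blockDim i)) _).symm.trans ?_
    rw [Fintype.sum_prod_type]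
    simp only [hcol, ite_mul, zero_mul]
    rw [Finset.sum_comm]
    simp
  rw [Finset.sum_apply, Fin.sum_univ_three, hpart, hpart, hpart]
  rfl

lemma pddStrategy_decodable {m : ℕ} (hm : 3 ≤ m) (n : ℕ) (μ : Measure ℂ)
    [IsProbabilityMeasure μ] (hac : μ ≪ (volume : Measure ℂ)) :
    (pddStrategy hm n).Decodable μ := by
  intro j
  have hgood : ∀ᵐ g ∂chanMeasure 3 m n μ, ∀ b : Fin (n / 4), GoodBlock (blockChan hm b g) :=
    ae_all_iff.2 fun b =>
      ae_goodBlock hac (blockSlot_injective b) (Fin.castLE_injective hm)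
  filter_upwards [hgood] with g hg
  refine rank_condition_of_kernel _ j g fun x hx => ?_
  have hz : ∀ b τ, blockSignal (blockChan hm b g) j τ (fun s => x 0 (finProdFinEquiv (b, s)))
      (fun s => x 1 (finProdFinEquiv (b, s))) (fun s => x 2 (finProdFinEquiv (b, s))) = 0 := by
    intro b τ
    rw [← pddStrategy_signal hm j g x b τ]
    exact congrFun hx _
  have hx0 : ∀ b s, x j (finProdFinEquiv (b, s)) = 0 := by
    intro b s
    fin_cases j
    · exact congrFun (decode_zero (hg b) (hz b)) s
    · exact congrFun (decode_one (hg b) (hz b)) s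
    · exact congrFun (decode_two (hg b) (hz b)) s
  funext c
  obtain ⟨⟨b, s⟩, rfl⟩ := (finProdFinEquiv (m := n / 4) (n := blockDim j)).surjective c
  exact hx0 b s

lemma tendsto_div_four : Tendsto (fun n : ℕ => ((n / 4 : ℕ) : ℝ) / n) atTop (𝓝 (1 / 4)) := by
  have := (tendsto_nat_floor_mul_div_atTop (R := ℝ) (a := 1 / 4) (by norm_num)).comp
    tendsto_natCast_atTop_atTop
  refine this.congr fun n => ?_
  have h : ⌊(1 / 4 : ℝ) * n⌋₊ = n / 4 := by
    rw [← Nat.floor_div_eq_div (K := ℝ) n 4]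
    congr 1
    push_cast
    ring
  simp only [Function.comp_apply, h]

/-- **Achievability of `(3/4, 1/2, 1/2)` for the `PDD` configuration.** For the 3-user
MISO BC where receiver 1 supplies instantaneous CSIT and receivers 2 and 3 supply delayed
CSIT, the DoF tuple `(3/4, 1/2, 1/2)` is linearly achievable. -/
theorem pdd_achievability (m : ℕ) (hm : 3 ≤ m)
    (μ : Measure ℂ) [IsProbabilityMeasure μ] (hac : μ ≪ (volume : Measure ℂ)) :
    LinAchievable 3 m ![CSITState.P, CSITState.D, CSITState.D] μ
      ![3 / 4, 1 / 2, 1 / 2] := by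
  refine ⟨?_, pddStrategy hm, fun n => pddStrategy_decodable hm n μ hac, fun j => ?_⟩
  · intro j
    fin_cases j <;> norm_num
  · have h := tendsto_div_four.mul_const (blockDim j : ℝ)
    have hlim : (1 / 4 : ℝ) * blockDim j = (![3 / 4, 1 / 2, 1 / 2] : Fin 3 → ℝ) j := by
      fin_cases j <;> norm_num [blockDim]
    rw [hlim] at h
    refine h.congr fun n => ?_
    simp only [pddStrategy]
    push_cast
    ring

end
end
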